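/- arXiv:2210.17184 — 5 statements merged into one kernel-verified Lean document; each statement's English description precedes it below -/
import Mathlib

section
/- Let E be a group, N a normal subgroup of E, p : E → Q the quotient homomorphism onto Q = E/N, and s : Q → E a group homomorphism with p ∘ s = id. Let A be a group equipped with an action of Q by group automorphisms, and let f : N → A be a group homomorphism satisfying f(s(q) * n * s(q)⁻¹) = q • f(n) for all q ∈ Q and n ∈ N. Then the map φ : E → A defined by φ(σ) = f(σ * s(p(σ))⁻¹) restricts to f on N and satisfies the 1-cocycle identity φ(σ * τ) = φ(σ) * (p(σ) • φ(τ)) for all σ, τ ∈ E. -/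
/-- Let `E` be a group, `N` a normal subgroup, `p : E → Q` the quotient map onto
`Q = E/N` (i.e. `p` is surjective with kernel `N`), and `s : Q → E` a homomorphic
section of `p`.  Let `A` be a group with an action of `Q` by group automorphisms and
`f : N → A` a homomorphism satisfying `f(s(q) n s(q)⁻¹) = q • f(n)`.  Then the map
`φ : E → A` defined by `φ(σ) = f(σ · s(p(σ))⁻¹)` restricts to `f` on `N` and satisfies
the 1-cocycle identity `φ(στ) = φ(σ) · (p(σ) • φ(τ))`. -/
theorem stmt_0 {E Q A : Type*} [Group E] [Group Q] [Group A]
    (N : Subgroup E) (hN : N.Normal)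
    (p : E →* Q) (hp : Function.Surjective p) (hker : p.ker = N)
    (s : Q →* E) (hps : ∀ q : Q, p (s q) = q)
    [MulDistribMulAction Q A]
    (f : N →* A)
    (hf : ∀ (q : Q) (n : N), f ⟨s q * (n : E) * (s q)⁻¹, hN.conj_mem n n.2 (s q)⟩ = q • f n)
    (φ : E → A)
    (hφ : ∀ (σ : E) (h : σ * (s (p σ))⁻¹ ∈ N), φ σ = f ⟨σ * (s (p σ))⁻¹, h⟩) :
    (∀ n : N, φ n = f n) ∧ ∀ σ τ : E, φ (σ * τ) = φ σ * (p σ • φ τ) := by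
  have hmem (σ : E) : σ * (s (p σ))⁻¹ ∈ N := by
    rw [← hker, MonoidHom.mem_ker, map_mul, map_inv, hps, mul_inv_cancel]
  refine ⟨fun n => ?_, fun σ τ => ?_⟩
  · have hn : p n = 1 := by
      rw [← MonoidHom.mem_ker, hker]
      exact n.2
    rw [hφ n (hmem n)]
    congr 1
    ext
    simp [hn]
  · rw [hφ _ (hmem (σ * τ)), hφ σ (hmem σ), hφ τ (hmem τ), ← hf, ← map_mul]
    congr 1
    ext
    simp [mul_assoc]
end

section
/- Let r ≥ 0 and let e₁, …, e_r and f₁, …, f_r be positive integers. Let G be the abelian group with generators h, P₁, …, P_r and relations eᵢ·Pᵢ = fᵢ·h for each i, and let deg : G → ℚ be the (well-defined) group homomorphism determined by deg(h) = 1 and deg(Pᵢ) = fᵢ/eᵢ. Set dᵢ = eᵢ / gcd(eᵢ, fᵢ) and d = lcm(d₁, …, d_r) (with d = 1 if r = 0). Then: (a) the image of deg is exactly (1/d)·ℤ ⊆ ℚ; (b) the homomorphism q : ⊕ᵢ ℤ/eᵢℤ → ((1/d)ℤ)/ℤ sending the i-th standard generator to the class of fᵢ/eᵢ is surjective; (c)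 the homomorphism G → ⊕ᵢ ℤ/eᵢℤ sending the class of Σᵢ aᵢPᵢ + b·h to (aᵢ mod eᵢ)ᵢ is well defined, its restriction to ker(deg) is injective, and its image on ker(deg) equals ker(q); in other words there is a short exact sequence 0 → ker(deg) → ⊕ᵢ ℤ/eᵢℤ → ((1/d)ℤ)/ℤ → 0. -/
open scoped DirectSum
/-! The abelian group `G` with generators `h, P₁, …, P_r` and relations `eᵢ·Pᵢ = fᵢ·h`,
realized as a quotient of the free abelian group on `Option (Fin r)` (`none ↦ h`,
`some i ↦ Pᵢ`). -/

/-- The subgroup of relations `eᵢ·Pᵢ − fᵢ·h`. -/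
def presRel (r : ℕ) (e f : Fin r → ℕ) : AddSubgroup (FreeAbelianGroup (Option (Fin r))) :=
  AddSubgroup.closure
    {x | ∃ i : Fin r, x = (e i : ℤ) • FreeAbelianGroup.of (Option.some i)
        - (f i : ℤ) • FreeAbelianGroup.of (Option.none : Option (Fin r))}

/-- The abelian group with generators `h, P₁, …, P_r` and relations `eᵢ·Pᵢ = fᵢ·h`. -/
def PresGroup (r : ℕ) (e f : Fin r → ℕ) : Type :=
  FreeAbelianGroup (Option (Fin r)) ⧸ presRel r e f

instance (r : ℕ) (e f : Fin r → ℕ) : AddCommGroup (PresGroup r e f) :=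
  inferInstanceAs (AddCommGroup (FreeAbelianGroup (Option (Fin r)) ⧸ presRel r e f))

/-- The generator `h` of `PresGroup r e f`. -/
def hgen (r : ℕ) (e f : Fin r → ℕ) : PresGroup r e f :=
  QuotientAddGroup.mk (FreeAbelianGroup.of (Option.none : Option (Fin r)))

/-- The generator `Pᵢ` of `PresGroup r e f`. -/
def Pgen (r : ℕ) (e f : Fin r → ℕ) (i : Fin r) : PresGroup r e f :=
  QuotientAddGroup.mk (FreeAbelianGroup.of (Option.some i))

namespace PresGroup

variable {r : ℕ} {e f : Fin r → ℕ}

/-- The universal property of `PresGroup`: images of the generators satisfying the relations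
determine a homomorphism. -/
def lift {A : Type*} [AddCommGroup A] (a : A) (b : Fin r → A)
    (hab : ∀ i, (e i : ℤ) • b i = (f i : ℤ) • a) : PresGroup r e f →+ A :=
  QuotientAddGroup.lift (presRel r e f)
    (FreeAbelianGroup.lift fun o : Option (Fin r) => o.elim a b) (by
      refine (AddSubgroup.closure_le _).2 ?_
      rintro _ ⟨i, rfl⟩
      simp [hab i, -natCast_zsmul])

section lift

variable {A : Type*} [AddCommGroup A] (a : A) (b : Fin r → A)
  (hab : ∀ i, (e i : ℤ) • b i = (f i : ℤ) • a)

theorem lift_hgen : lift a b hab (hgen r e f) = a :=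
  FreeAbelianGroup.lift_apply_of (fun o : Option (Fin r) => o.elim a b) none

theorem lift_Pgen (i : Fin r) : lift a b hab (Pgen r e f i) = b i :=
  FreeAbelianGroup.lift_apply_of (fun o : Option (Fin r) => o.elim a b) (some i)

end lift

theorem hom_ext {A : Type*} [AddCommGroup A] {φ ψ : PresGroup r e f →+ A}
    (hh : φ (hgen r e f) = ψ (hgen r e f))
    (hP : ∀ i, φ (Pgen r e f i) = ψ (Pgen r e f i)) : φ = ψ := by
  refine QuotientAddGroup.addMonoidHom_ext (presRel r e f)
    (FreeAbelianGroup.lift.symm.injective (funext ?_))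
  rintro (_ | i)
  · exact hh
  · exact hP i

/-- The relations `eᵢ·Pᵢ = fᵢ·h` hold in `PresGroup`. -/
theorem zsmul_Pgen (i : Fin r) :
    (e i : ℤ) • Pgen r e f i = (f i : ℤ) • hgen r e f := by
  refine sub_eq_zero.1 ?_
  exact (QuotientAddGroup.eq_zero_iff _).2 (AddSubgroup.subset_closure ⟨i, rfl⟩)

/-- A homomorphism whose values on generators lie in a subgroup has range in that subgroup. -/
theorem range_le {A : Type*} [AddCommGroup A] (φ : PresGroup r e f →+ A) {H : AddSubgroup A}
    (hh : φ (hgen r e f) ∈ H) (hP : ∀ i, φ (Pgen r e f i) ∈ H) : φ.range ≤ H := by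
  have hφ : (QuotientAddGroup.mk' H).comp φ = 0 :=
    hom_ext ((QuotientAddGroup.eq_zero_iff _).2 hh) fun i =>
      (QuotientAddGroup.eq_zero_iff _).2 (hP i)
  rintro _ ⟨x, rfl⟩
  exact (QuotientAddGroup.eq_zero_iff _).1 (DFunLike.congr_fun hφ x)

end PresGroup

/-- The homomorphism out of `⨁ᵢ ℤ/eᵢℤ` sending the `i`-th standard generator to `b i`. -/
def directSumZModLift {r : ℕ} {e : Fin r → ℕ} {A : Type*} [AddCommGroup A] (b : Fin r → A)
    (hb : ∀ i, (e i : ℤ) • b i = 0) : (⨁ i : Fin r, ZMod (e i)) →+ A :=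
  DirectSum.toAddMonoid fun i => ZMod.lift (e i) ⟨zmultiplesHom A (b i), hb i⟩

theorem directSumZModLift_of {r : ℕ} {e : Fin r → ℕ} {A : Type*} [AddCommGroup A]
    (b : Fin r → A) (hb : ∀ i, (e i : ℤ) • b i = 0) (i : Fin r) :
    directSumZModLift b hb (DirectSum.of (fun i => ZMod (e i)) i 1) = b i := by
  have h := ZMod.lift_coe (e i) ⟨zmultiplesHom A (b i), hb i⟩ 1
  rw [Int.cast_one] at h
  simp [directSumZModLift, h]

theorem zsmul_directSum_of_one {r : ℕ} (e : Fin r → ℕ) (i : Fin r) :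
    (e i : ℤ) • DirectSum.of (fun i => ZMod (e i)) i 1 = 0 := by
  rw [← map_zsmul]
  simp

/-- A subgroup of `ℚ` containing `1/m` and `1/n` contains `1/lcm m n`. -/
theorem inv_lcm_mem {H : AddSubgroup ℚ} {m n : ℕ} (hm : (m : ℚ)⁻¹ ∈ H) (hn : (n : ℚ)⁻¹ ∈ H) :
    ((Nat.lcm m n : ℕ) : ℚ)⁻¹ ∈ H := by
  rcases Nat.eq_zero_or_pos m with rfl | hm0
  · simp
  rcases Nat.eq_zero_or_pos n with rfl | hn0
  · simp
  have hbez := congrArg (Int.cast : ℤ → ℚ) (Nat.gcd_eq_gcd_ab m n)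
  have hmul := congrArg (Nat.cast : ℕ → ℚ) (Nat.gcd_mul_lcm m n)
  push_cast at hbez hmul
  have hm' : (m : ℚ) ≠ 0 := by positivity
  have hn' : (n : ℚ) ≠ 0 := by positivity
  have hl : ((Nat.lcm m n : ℕ) : ℚ) ≠ 0 := by exact_mod_cast (Nat.lcm_pos hm0 hn0).ne'
  have key : ((Nat.lcm m n : ℕ) : ℚ)⁻¹ =
      m.gcdA n • (n : ℚ)⁻¹ + m.gcdB n • (m : ℚ)⁻¹ := by
    rw [zsmul_eq_mul, zsmul_eq_mul]
    field_simp
    linear_combination -hmul + (Nat.lcm m n : ℚ) * hbez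
  rw [key]
  exact H.add_mem (H.zsmul_mem hn _) (H.zsmul_mem hm _)

theorem inv_finset_lcm_mem {ι : Type*} {H : AddSubgroup ℚ} (h1 : (1 : ℚ) ∈ H) (s : Finset ι)
    (g : ι → ℕ) (hg : ∀ i ∈ s, (g i : ℚ)⁻¹ ∈ H) : ((s.lcm g : ℕ) : ℚ)⁻¹ ∈ H := by
  classical
  induction s using Finset.induction_on with
  | empty => simpa using h1
  | insert i s _ ih =>
    rw [Finset.lcm_insert]
    exact inv_lcm_mem (hg i (Finset.mem_insert_self i s))
      (ih fun j hj => hg j (Finset.mem_insert_of_mem hj))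

/-- A subgroup of `ℚ` containing `1` and `n/m` contains the inverse of the reduced denominator
of `n/m`. -/
theorem inv_div_gcd_mem {H : AddSubgroup ℚ} (h1 : (1 : ℚ) ∈ H) {m n : ℕ} (hm : 0 < m)
    (h : (n : ℚ) / m ∈ H) : ((m / Nat.gcd m n : ℕ) : ℚ)⁻¹ ∈ H := by
  have hbez := congrArg (Int.cast : ℤ → ℚ) (Nat.gcd_eq_gcd_ab m n)
  push_cast at hbez
  have hm' : (m : ℚ) ≠ 0 := by positivity
  have hg : ((Nat.gcd m n : ℕ) : ℚ) ≠ 0 := by exact_mod_cast (Nat.gcd_pos_of_pos_left n hm).ne'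
  have key : ((m / Nat.gcd m n : ℕ) : ℚ)⁻¹ = m.gcdA n • (1 : ℚ) + m.gcdB n • ((n : ℚ) / m) := by
    rw [Nat.cast_div (Nat.gcd_dvd_left m n) hg, inv_div, zsmul_eq_mul, zsmul_eq_mul, hbez]
    field_simp
  rw [key]
  exact H.add_mem (H.zsmul_mem h1 _) (H.zsmul_mem h _)

/-- A fraction `n/m` lies in `(1/d)ℤ` as soon as its reduced denominator divides `d`. -/
theorem div_mem_zmultiples_inv {m n d : ℕ} (hm : 0 < m) (hd : d ≠ 0)
    (h : m / Nat.gcd m n ∣ d) : (n : ℚ) / m ∈ AddSubgroup.zmultiples ((d : ℚ)⁻¹) := by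
  obtain ⟨k, hk⟩ := h
  obtain ⟨a, ha⟩ := Nat.gcd_dvd_left m n
  obtain ⟨b, hb⟩ := Nat.gcd_dvd_right m n
  have hg := Nat.gcd_pos_of_pos_left n hm
  generalize Nat.gcd m n = g at *
  subst ha hb
  rw [Nat.mul_div_cancel_left a hg] at hk
  subst hk
  obtain ⟨ha0, hk0⟩ := mul_ne_zero_iff.1 hd
  refine AddSubgroup.mem_zmultiples_iff.2 ⟨(b * k : ℕ), ?_⟩
  rw [zsmul_eq_mul]
  push_cast
  field_simp

/-- Let `G` be the abelian group with generators `h, P₁, …, P_r` and relations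
`eᵢ·Pᵢ = fᵢ·h`, let `deg : G → ℚ` be the well-defined homomorphism with `deg h = 1`,
`deg Pᵢ = fᵢ/eᵢ`, let `dᵢ = eᵢ/gcd(eᵢ, fᵢ)` and `d = lcm(d₁, …, d_r)`.  Then:
(a) the image of `deg` is `(1/d)·ℤ`;
(b) the homomorphism `q : ⊕ᵢ ℤ/eᵢℤ → ((1/d)ℤ)/ℤ ⊆ ℚ/ℤ` sending the `i`-th standard
generator to the class of `fᵢ/eᵢ` is surjective onto `((1/d)ℤ)/ℤ`;
(c) the homomorphism `π : G → ⊕ᵢ ℤ/eᵢℤ`, `Σᵢ aᵢPᵢ + b·h ↦ (aᵢ mod eᵢ)ᵢ`, is well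
defined, injective on `ker deg`, and maps `ker deg` onto `ker q`;
i.e. there is a short exact sequence `0 → ker deg → ⊕ᵢ ℤ/eᵢℤ → ((1/d)ℤ)/ℤ → 0`. -/
theorem stmt_2 (r : ℕ) (e f : Fin r → ℕ) (he : ∀ i, 0 < e i) (hf : ∀ i, 0 < f i)
    (d : ℕ) (hd : d = Finset.univ.lcm (fun i : Fin r => e i / Nat.gcd (e i) (f i))) :
    ∃ deg : PresGroup r e f →+ ℚ,
      -- `deg` is the (unique) homomorphism determined by `deg h = 1`, `deg Pᵢ = fᵢ/eᵢ`
      (deg (hgen r e f) = 1 ∧ ∀ i, deg (Pgen r e f i) = (f i : ℚ) / (e i : ℚ)) ∧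
      (∀ deg' : PresGroup r e f →+ ℚ,
        (deg' (hgen r e f) = 1 ∧ ∀ i, deg' (Pgen r e f i) = (f i : ℚ) / (e i : ℚ)) →
          deg' = deg) ∧
      -- (a) the image of `deg` is exactly `(1/d)·ℤ`
      Set.range deg = (AddSubgroup.zmultiples ((d : ℚ)⁻¹) : Set ℚ) ∧
      ∃ q : (⨁ i : Fin r, ZMod (e i)) →+ ℚ ⧸ AddSubgroup.zmultiples (1 : ℚ),
        -- `q` sends the `i`-th standard generator to the class of `fᵢ/eᵢ` in `ℚ/ℤ`
        (∀ i : Fin r, q (DirectSum.of (fun i => ZMod (e i)) i 1) =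
          QuotientAddGroup.mk ((f i : ℚ) / (e i : ℚ))) ∧
        -- (b) the image of `q` is exactly `((1/d)ℤ)/ℤ ⊆ ℚ/ℤ`
        Set.range q =
          QuotientAddGroup.mk '' (AddSubgroup.zmultiples ((d : ℚ)⁻¹) : Set ℚ) ∧
        -- (c) the map `π` is well defined, injective on `ker deg`, with image `ker q`
        ∃ π : PresGroup r e f →+ ⨁ i : Fin r, ZMod (e i),
          (π (hgen r e f) = 0 ∧
            ∀ i, π (Pgen r e f i) = DirectSum.of (fun i => ZMod (e i)) i 1) ∧
          (∀ x y : PresGroup r e f, deg x = 0 → deg y = 0 → π x = π y → x = y) ∧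
          π '' {x | deg x = 0} = {y | q y = 0} := by
  have he' : ∀ i, (e i : ℚ) ≠ 0 := fun i => by exact_mod_cast (he i).ne'
  have hd0 : d ≠ 0 := by
    rw [hd, Ne, Finset.lcm_eq_zero_iff]
    rintro ⟨i, -, hi⟩
    exact (Nat.div_pos (Nat.gcd_le_left _ (he i)) (Nat.gcd_pos_of_pos_left _ (he i))).ne' hi
  obtain ⟨deg, deg_h, deg_P⟩ : ∃ deg : PresGroup r e f →+ ℚ, deg (hgen r e f) = 1 ∧
      ∀ i, deg (Pgen r e f i) = (f i : ℚ) / (e i : ℚ) :=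
    have hrel : ∀ i, (e i : ℤ) • ((f i : ℚ) / (e i : ℚ)) = (f i : ℤ) • (1 : ℚ) := fun i => by
      have := he' i
      rw [zsmul_eq_mul, zsmul_eq_mul]
      push_cast
      field_simp
    ⟨PresGroup.lift 1 _ hrel, PresGroup.lift_hgen _ _ _, PresGroup.lift_Pgen _ _ _⟩
  obtain ⟨q, hq⟩ : ∃ q : (⨁ i : Fin r, ZMod (e i)) →+ ℚ ⧸ AddSubgroup.zmultiples (1 : ℚ),
      ∀ i : Fin r, q (DirectSum.of (fun i => ZMod (e i)) i 1) =
        QuotientAddGroup.mk ((f i : ℚ) / (e i : ℚ)) :=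
    have hrel : ∀ i, (e i : ℤ) •
        (QuotientAddGroup.mk ((f i : ℚ) / (e i : ℚ)) : ℚ ⧸ AddSubgroup.zmultiples (1 : ℚ)) = 0 :=
      fun i => by
        have := he' i
        refine (QuotientAddGroup.eq_zero_iff ((e i : ℤ) • ((f i : ℚ) / (e i : ℚ)))).2
          (AddSubgroup.mem_zmultiples_iff.2 ⟨f i, ?_⟩)
        rw [zsmul_eq_mul, zsmul_eq_mul]
        push_cast
        field_simp
    ⟨directSumZModLift _ hrel, directSumZModLift_of _ _⟩
  obtain ⟨π, π_h, π_P⟩ : ∃ π : PresGroup r e f →+ ⨁ i : Fin r, ZMod (e i),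
      π (hgen r e f) = 0 ∧ ∀ i, π (Pgen r e f i) = DirectSum.of (fun i => ZMod (e i)) i 1 :=
    ⟨PresGroup.lift 0 (fun i => DirectSum.of (fun i => ZMod (e i)) i 1)
        fun i => by rw [zsmul_directSum_of_one, smul_zero],
      PresGroup.lift_hgen _ _ _, PresGroup.lift_Pgen _ _ _⟩
  have hrange : deg.range = AddSubgroup.zmultiples ((d : ℚ)⁻¹) := by
    refine le_antisymm (PresGroup.range_le deg ?_ fun i => ?_) ?_
    · rw [deg_h]
      refine AddSubgroup.mem_zmultiples_iff.2 ⟨d, ?_⟩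
      simp [hd0]
    · rw [deg_P]
      exact div_mem_zmultiples_inv (he i) hd0 (hd ▸ Finset.dvd_lcm (Finset.mem_univ i))
    · rw [AddSubgroup.zmultiples_le, hd]
      have h1 : (1 : ℚ) ∈ deg.range := ⟨_, deg_h⟩
      exact inv_finset_lcm_mem h1 _ _ fun i _ => inv_div_gcd_mem h1 (he i) ⟨_, deg_P i⟩
  have hqπ : ∀ x, q (π x) = QuotientAddGroup.mk (deg x) := by
    have : q.comp π = (QuotientAddGroup.mk' (AddSubgroup.zmultiples (1 : ℚ))).comp deg := by
      refine PresGroup.hom_ext ?_ fun i => ?_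
      · simp only [AddMonoidHom.comp_apply, π_h, deg_h, map_zero]
        exact ((QuotientAddGroup.eq_zero_iff _).2 (AddSubgroup.mem_zmultiples 1)).symm
      · simp only [AddMonoidHom.comp_apply, π_P, deg_P, hq]
        rfl
    exact DFunLike.congr_fun this
  have hπ : Function.Surjective π := by
    intro y
    induction y using DirectSum.induction_on with
    | zero => exact ⟨0, map_zero π⟩
    | of i a =>
      obtain ⟨n, rfl⟩ := ZMod.intCast_surjective a
      refine ⟨n • Pgen r e f i, ?_⟩
      rw [map_zsmul, π_P, ← map_zsmul, zsmul_one]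
    | add y z hy hz =>
      obtain ⟨x, rfl⟩ := hy
      obtain ⟨x', rfl⟩ := hz
      exact ⟨x + x', map_add π x x'⟩
  have hker : ∀ x, π x = 0 → ∃ n : ℤ, n • hgen r e f = x := by
    let H := AddSubgroup.zmultiples (hgen r e f)
    have hrel : ∀ i, (e i : ℤ) • (QuotientAddGroup.mk (Pgen r e f i) : PresGroup r e f ⧸ H) = 0 :=
      fun i => (QuotientAddGroup.eq_zero_iff ((e i : ℤ) • Pgen r e f i)).2
        (AddSubgroup.mem_zmultiples_iff.2 ⟨f i, (PresGroup.zsmul_Pgen i).symm⟩)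
    have hσ : (directSumZModLift _ hrel).comp π = QuotientAddGroup.mk' H := by
      refine PresGroup.hom_ext ?_ fun i => ?_
      · rw [AddMonoidHom.comp_apply, π_h, map_zero]
        exact ((QuotientAddGroup.eq_zero_iff _).2 (AddSubgroup.mem_zmultiples _)).symm
      · rw [AddMonoidHom.comp_apply, π_P, directSumZModLift_of]
        rfl
    intro x hx
    have h := DFunLike.congr_fun hσ x
    rw [AddMonoidHom.comp_apply, hx, map_zero] at h
    exact AddSubgroup.mem_zmultiples_iff.1 ((QuotientAddGroup.eq_zero_iff x).1 h.symm)
  refine ⟨deg, ⟨deg_h, deg_P⟩, fun deg' h => PresGroup.hom_ext (h.1.trans deg_h.symm)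
    fun i => (h.2 i).trans (deg_P i).symm, ?_, q, hq, ?_, π, ⟨π_h, π_P⟩, ?_, ?_⟩
  · rw [← hrange, AddMonoidHom.coe_range]
  · rw [← hrange, AddMonoidHom.coe_range, ← Set.range_comp, ← hπ.range_comp]
    exact congrArg Set.range (funext hqπ)
  · intro x y hx hy hxy
    obtain ⟨n, hn⟩ := hker (x - y) (by rw [map_sub, hxy, sub_self])
    have h := congrArg deg hn
    rw [map_zsmul, deg_h, map_sub, hx, hy, sub_zero, zsmul_one, Int.cast_eq_zero] at h
    rw [h, zero_smul] at hn
    exact sub_eq_zero.1 hn.symm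
  · ext y
    constructor
    · rintro ⟨x, hx, rfl⟩
      change q (π x) = 0
      rw [hqπ, show deg x = 0 from hx]
      rfl
    · intro hy
      obtain ⟨x, rfl⟩ := hπ y
      have h : (QuotientAddGroup.mk (deg x) : ℚ ⧸ AddSubgroup.zmultiples (1 : ℚ)) = 0 :=
        (hqπ x).symm.trans hy
      obtain ⟨n, hn⟩ := AddSubgroup.mem_zmultiples_iff.1 ((QuotientAddGroup.eq_zero_iff _).1 h)
      refine ⟨x - n • hgen r e f, ?_, ?_⟩
      · change deg _ = 0
        rw [map_sub, map_zsmul, deg_h, hn, sub_self]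
      · rw [map_sub, map_zsmul, π_h, smul_zero, sub_zero]
end

section
/- Let a, b, c ∈ ℤ, set f(x,y) = ax² + bxy + cy² and q = b² − 4ac, and assume q ≠ 0 and q is not the square of a rational number (this forces a ≠ 0). Let V = {∞, 2} ∪ {p prime : p ∣ q}, and set εᵥ = (a, −aq)ᵥ for v ∈ V. Then the following are equivalent: (i) there exists (x, y) ∈ ℚ² with f(x,y) ≠ 0 such that v_p(f(x,y)) is even for every prime p not dividing 2q; (ii) there is no nonzero integer d dividing 2q with the following two properties: for every v ∈ V, d or d/q is a square in ℚᵥ×, and both ∏_{v ∈ V, d not a square in ℚᵥ} εᵥ = −1 and ∏_{v ∈ V, d a square in ℚᵥ} εᵥ = −1. -/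
open scoped Classical

/-- `IsSquareQp p d`: `d` is a square in `ℚ_p` (taken to be `True` for non-prime `p`;
for `d ≠ 0` this is the same as being a square in `ℚ_p^×`). -/
def IsSquareQp (p : ℕ) (d : ℚ) : Prop :=
  if h : p.Prime then
    haveI : Fact p.Prime := ⟨h⟩
    ∃ t : ℚ_[p], (d : ℚ_[p]) = t ^ 2
  else True

/-- `IsSquareR d`: `d` is a square in `ℝ`. -/
def IsSquareR (d : ℚ) : Prop :=
  ∃ t : ℝ, (d : ℝ) = t ^ 2

/-- The Hilbert symbol `(α, β)_p ∈ {±1}`: it is `1` iff `z² = αx² + βy²` has a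
nontrivial solution in `ℚ_p` (defined to be `1` for non-prime `p`). -/
noncomputable def hilbertQp (p : ℕ) (α β : ℚ) : ℤ :=
  if h : p.Prime then
    haveI : Fact p.Prime := ⟨h⟩
    if ∃ x y z : ℚ_[p], ¬(x = 0 ∧ y = 0 ∧ z = 0) ∧
        z ^ 2 = (α : ℚ_[p]) * x ^ 2 + (β : ℚ_[p]) * y ^ 2 then 1 else -1
  else 1

/-- The Hilbert symbol `(α, β)_∞ ∈ {±1}`: it is `1` iff `z² = αx² + βy²` has a
nontrivial solution in `ℝ`. -/
noncomputable def hilbertR (α β : ℚ) : ℤ :=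
  if ∃ x y z : ℝ, ¬(x = 0 ∧ y = 0 ∧ z = 0) ∧
      z ^ 2 = (α : ℝ) * x ^ 2 + (β : ℝ) * y ^ 2 then 1 else -1

open scoped NumberTheorySymbols

/-- The prime-to-`p` part of a nonzero integer. -/
def unitPart (p : ℕ) (α : ℤ) : ℤ := α / (p : ℤ) ^ padicValInt p α

theorem eq_pow_mul_unitPart (p : ℕ) (α : ℤ) :
    α = (p : ℤ) ^ padicValInt p α * unitPart p α :=
  (Int.mul_ediv_cancel' (padicValInt_dvd α)).symm

theorem not_dvd_unitPart {p : ℕ} (hp : p.Prime) {α : ℤ} (hα : α ≠ 0) :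
    ¬(p : ℤ) ∣ unitPart p α := by
  have := Fact.mk hp
  rintro ⟨c, hc⟩
  have h := eq_pow_mul_unitPart p α
  rw [hc, ← mul_assoc, ← pow_succ] at h
  have h2 : (p : ℤ) ^ (padicValInt p α + 1) ∣ α := ⟨c, h⟩
  rw [padicValInt_dvd_iff] at h2
  omega

theorem padicValInt_pow_mul {p : ℕ} (hp : p.Prime) (i : ℕ) {u : ℤ} (hu : ¬(p : ℤ) ∣ u) :
    padicValInt p ((p : ℤ) ^ i * u) = i := by
  have := Fact.mk hp
  have hp0 : (p : ℤ) ≠ 0 := by exact_mod_cast hp.ne_zero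
  have hu0 : u ≠ 0 := by rintro rfl; simp at hu
  induction i with
  | zero => simpa using padicValInt.eq_zero_of_not_dvd hu
  | succ n ih =>
    rw [pow_succ, mul_right_comm, padicValInt_mul_eq_succ _ (mul_ne_zero (pow_ne_zero _ hp0) hu0),
      ih]

theorem unitPart_pow_mul {p : ℕ} (hp : p.Prime) (i : ℕ) {u : ℤ} (hu : ¬(p : ℤ) ∣ u) :
    unitPart p ((p : ℤ) ^ i * u) = u := by
  have hp0 : (p : ℤ) ≠ 0 := by exact_mod_cast hp.ne_zero
  rw [unitPart, padicValInt_pow_mul hp i hu, Int.mul_ediv_cancel_left _ (pow_ne_zero _ hp0)]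

theorem not_dvd_mul {p : ℕ} (hp : p.Prime) {u v : ℤ} (hu : ¬(p : ℤ) ∣ u) (hv : ¬(p : ℤ) ∣ v) :
    ¬(p : ℤ) ∣ u * v := by
  rw [(Nat.prime_iff_prime_int.mp hp).dvd_mul]
  tauto

theorem padicValInt_unitPart_mul {p : ℕ} (hp : p.Prime) {α β : ℤ} (hα : α ≠ 0) (hβ : β ≠ 0) :
    padicValInt p (α * β) = padicValInt p α + padicValInt p β ∧
      unitPart p (α * β) = unitPart p α * unitPart p β := by
  have h := not_dvd_mul hp (not_dvd_unitPart hp hα) (not_dvd_unitPart hp hβ)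
  have e : α * β = (p : ℤ) ^ (padicValInt p α + padicValInt p β) *
      (unitPart p α * unitPart p β) := by
    conv_lhs => rw [eq_pow_mul_unitPart p α, eq_pow_mul_unitPart p β]
    ring
  constructor
  · rw [e, padicValInt_pow_mul hp _ h]
  · rw [e, unitPart_pow_mul hp _ h]

theorem padicValInt_unitPart_of_not_dvd {p : ℕ} (hp : p.Prime) {u : ℤ} (hu : ¬(p : ℤ) ∣ u) :
    padicValInt p u = 0 ∧ unitPart p u = u := by
  have h1 := padicValInt_pow_mul hp 0 hu
  have h2 := unitPart_pow_mul hp 0 hu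
  simp only [pow_zero, one_mul] at h1 h2
  exact ⟨h1, h2⟩

theorem padicValInt_unitPart_self {p : ℕ} (hp : p.Prime) :
    padicValInt p (p : ℤ) = 1 ∧ unitPart p (p : ℤ) = 1 := by
  have hu : ¬(p : ℤ) ∣ 1 := (Nat.prime_iff_prime_int.mp hp).not_dvd_one
  have h1 := padicValInt_pow_mul hp 1 hu
  have h2 := unitPart_pow_mul hp 1 hu
  simp only [pow_one, mul_one] at h1 h2
  exact ⟨h1, h2⟩

/-- The Hilbert symbol of two signs: `-1` iff both are `-1`. -/
def signSymbol (x y : ℤ) : ℤ := if x = -1 ∧ y = -1 then -1 else 1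

/-- The explicit formula for the Hilbert symbol of nonzero integers at the prime `p`. -/
noncomputable def primeSymbol (p : ℕ) (α β : ℤ) : ℤ :=
  if p = 2 then
    signSymbol (ZMod.χ₄ (unitPart 2 α)) (ZMod.χ₄ (unitPart 2 β)) *
      ZMod.χ₈ (unitPart 2 α) ^ padicValInt 2 β * ZMod.χ₈ (unitPart 2 β) ^ padicValInt 2 α
  else
    J(-1 | p) ^ (padicValInt p α * padicValInt p β) *
      J(unitPart p α | p) ^ padicValInt p β * J(unitPart p β | p) ^ padicValInt p α

/-- The explicit formula for the Hilbert symbol of nonzero integers at the real place. -/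
noncomputable def realSymbol (α β : ℤ) : ℤ := signSymbol α.sign β.sign

theorem signSymbol_comm (x y : ℤ) : signSymbol x y = signSymbol y x := by
  simp [signSymbol, and_comm]

theorem signSymbol_eq_or (x y : ℤ) : signSymbol x y = 1 ∨ signSymbol x y = -1 := by
  unfold signSymbol; split_ifs <;> simp

theorem signSymbol_mul_left {x x' : ℤ} (hx : x = 1 ∨ x = -1) (hx' : x' = 1 ∨ x' = -1) (y : ℤ) :
    signSymbol (x * x') y = signSymbol x y * signSymbol x' y := by
  rcases hx with rfl | rfl <;> rcases hx' with rfl | rfl <;> by_cases hy : y = -1 <;>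
    simp [signSymbol, hy]

theorem chi_four_eq_or {u : ℤ} (hu : ¬(2 : ℤ) ∣ u) :
    ZMod.χ₄ (u : ZMod 4) = 1 ∨ ZMod.χ₄ (u : ZMod 4) = -1 := by
  rw [ZMod.χ₄_int_eq_if_mod_four]; split_ifs <;> simp_all

theorem chi_eight_eq_or {u : ℤ} (hu : ¬(2 : ℤ) ∣ u) :
    ZMod.χ₈ (u : ZMod 8) = 1 ∨ ZMod.χ₈ (u : ZMod 8) = -1 := by
  rw [ZMod.χ₈_int_eq_if_mod_eight]; split_ifs <;> simp_all

theorem jacobiSym_eq_or {p : ℕ} (hp : p.Prime) {u : ℤ} (hu : ¬(p : ℤ) ∣ u) :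
    J(u | p) = 1 ∨ J(u | p) = -1 := by
  apply jacobiSym.eq_one_or_neg_one
  rw [← Int.isCoprime_iff_gcd_eq_one]
  exact ((Nat.prime_iff_prime_int.mp hp).coprime_iff_not_dvd.mpr hu).symm

theorem not_dvd_neg_one {p : ℕ} (hp : p.Prime) : ¬(p : ℤ) ∣ -1 := by
  rw [dvd_neg]; exact (Nat.prime_iff_prime_int.mp hp).not_dvd_one

theorem pow_eq_or {x : ℤ} (hx : x = 1 ∨ x = -1) (n : ℕ) : x ^ n = 1 ∨ x ^ n = -1 := by
  rcases hx with rfl | rfl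
  · simp
  · exact neg_one_pow_eq_or ℤ n

theorem mul_eq_or {x y : ℤ} (hx : x = 1 ∨ x = -1) (hy : y = 1 ∨ y = -1) :
    x * y = 1 ∨ x * y = -1 := by
  rcases hx with rfl | rfl <;> rcases hy with rfl | rfl <;> simp

theorem primeSymbol_eq_or {p : ℕ} (hp : p.Prime) {α β : ℤ} (hα : α ≠ 0) (hβ : β ≠ 0) :
    primeSymbol p α β = 1 ∨ primeSymbol p α β = -1 := by
  have h1 := not_dvd_unitPart hp hα
  have h2 := not_dvd_unitPart hp hβ
  unfold primeSymbol
  split_ifs with h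
  · subst h
    exact mul_eq_or (mul_eq_or (signSymbol_eq_or _ _) (pow_eq_or (chi_eight_eq_or h1) _))
      (pow_eq_or (chi_eight_eq_or h2) _)
  · exact mul_eq_or (mul_eq_or (pow_eq_or (jacobiSym_eq_or hp (not_dvd_neg_one hp)) _)
      (pow_eq_or (jacobiSym_eq_or hp h1) _)) (pow_eq_or (jacobiSym_eq_or hp h2) _)

theorem primeSymbol_comm (p : ℕ) (α β : ℤ) : primeSymbol p α β = primeSymbol p β α := by
  unfold primeSymbol
  split_ifs
  · rw [signSymbol_comm]; ring
  · rw [mul_comm (padicValInt p α)]; ring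

theorem primeSymbol_mul_left {p : ℕ} (hp : p.Prime) {α α' : ℤ} (hα : α ≠ 0) (hα' : α' ≠ 0)
    (β : ℤ) : primeSymbol p (α * α') β = primeSymbol p α β * primeSymbol p α' β := by
  obtain ⟨h1, h2⟩ := padicValInt_unitPart_mul hp hα hα'
  unfold primeSymbol
  split_ifs with h
  · subst h
    rw [h1, h2]
    push_cast
    rw [map_mul, map_mul, signSymbol_mul_left (chi_four_eq_or (not_dvd_unitPart hp hα))
      (chi_four_eq_or (not_dvd_unitPart hp hα'))]
    ring
  · rw [h1, h2, jacobiSym.mul_left]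
    ring

theorem primeSymbol_of_even {p : ℕ} (hp : p.Prime) (hp2 : p ≠ 2) {α β : ℤ}
    (hβ : ¬(p : ℤ) ∣ β) (h : Even (padicValInt p α)) : primeSymbol p α β = 1 := by
  obtain ⟨h1, h2⟩ := padicValInt_unitPart_of_not_dvd hp hβ
  obtain ⟨k, hk⟩ := h
  rw [primeSymbol, if_neg hp2, h1, h2, hk, ← two_mul, pow_mul]
  rcases jacobiSym_eq_or hp hβ with h | h <;> simp [h]

theorem primeSymbol_of_not_dvd {p : ℕ} (hp : p.Prime) (hp2 : p ≠ 2) {α β : ℤ}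
    (hα : ¬(p : ℤ) ∣ α) (hβ : ¬(p : ℤ) ∣ β) : primeSymbol p α β = 1 :=
  primeSymbol_of_even hp hp2 hβ
    (by rw [(padicValInt_unitPart_of_not_dvd hp hα).1]; exact Even.zero)

/-- If `β` is prime to `p` then the symbol of a uniformiser with `β` is the Legendre symbol. -/
theorem primeSymbol_pow_mul_unit {p : ℕ} (hp : p.Prime) (hp2 : p ≠ 2) {β : ℤ} (i : ℕ)
    {u : ℤ} (hu : ¬(p : ℤ) ∣ u) (hβ : ¬(p : ℤ) ∣ β) :
    primeSymbol p ((p : ℤ) ^ i * u) β = J(β | p) ^ i := by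
  obtain ⟨h1, h2⟩ := padicValInt_unitPart_of_not_dvd hp hβ
  rw [primeSymbol, if_neg hp2, h1, h2, padicValInt_pow_mul hp i hu]
  simp

theorem realSymbol_comm (α β : ℤ) : realSymbol α β = realSymbol β α := signSymbol_comm _ _

theorem sign_eq_or {α : ℤ} (hα : α ≠ 0) : α.sign = 1 ∨ α.sign = -1 := by
  rcases lt_or_gt_of_ne hα with h | h
  · right; exact Int.sign_eq_neg_one_of_neg h
  · left; exact Int.sign_eq_one_of_pos h

theorem realSymbol_mul_left {α α' : ℤ} (hα : α ≠ 0) (hα' : α' ≠ 0) (β : ℤ) :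
    realSymbol (α * α') β = realSymbol α β * realSymbol α' β := by
  rw [realSymbol, Int.sign_mul, signSymbol_mul_left (sign_eq_or hα) (sign_eq_or hα')]
  rfl

/-- The product of the symbols at the real place and at the primes in `P`. -/
noncomputable def symbolProd (P : Finset ℕ) (α β : ℤ) : ℤ :=
  realSymbol α β * ∏ p ∈ P, primeSymbol p α β

theorem symbolProd_comm (P : Finset ℕ) (α β : ℤ) : symbolProd P α β = symbolProd P β α := by
  simp only [symbolProd, realSymbol_comm α, primeSymbol_comm _ α]

theorem symbolProd_mul_left {P : Finset ℕ} (hP : ∀ p ∈ P, p.Prime) {α α' : ℤ} (hα : α ≠ 0)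
    (hα' : α' ≠ 0) (β : ℤ) : symbolProd P (α * α') β = symbolProd P α β * symbolProd P α' β := by
  rw [symbolProd, realSymbol_mul_left hα hα',
    Finset.prod_congr rfl fun p hp => primeSymbol_mul_left (hP p hp) hα hα' β,
    Finset.prod_mul_distrib, symbolProd, symbolProd]
  ring

theorem symbolProd_eq_prod_subset {P P' : Finset ℕ} (hP : P ⊆ P') {α β : ℤ}
    (h : ∀ p ∈ P', p ∉ P → primeSymbol p α β = 1) : symbolProd P' α β = symbolProd P α β := by
  rw [symbolProd, symbolProd, Finset.prod_subset hP h]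

theorem primeSymbol_two_of_odd {α β : ℤ} (hα : ¬(2 : ℤ) ∣ α) (hβ : ¬(2 : ℤ) ∣ β) :
    primeSymbol 2 α β = signSymbol (ZMod.χ₄ α) (ZMod.χ₄ β) := by
  obtain ⟨h1, h2⟩ := padicValInt_unitPart_of_not_dvd Nat.prime_two hα
  obtain ⟨h3, h4⟩ := padicValInt_unitPart_of_not_dvd Nat.prime_two hβ
  rw [primeSymbol, if_pos rfl, h1, h2, h3, h4]
  simp

theorem signSymbol_self {x : ℤ} (hx : x = 1 ∨ x = -1) : signSymbol x x = x := by
  rcases hx with rfl | rfl <;> simp [signSymbol]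

theorem signSymbol_one_left (x : ℤ) : signSymbol 1 x = 1 := by simp [signSymbol]

theorem signSymbol_neg_one_left {x : ℤ} (hx : x = 1 ∨ x = -1) : signSymbol (-1) x = x := by
  rcases hx with rfl | rfl <;> simp [signSymbol]

theorem odd_prime_facts {p : ℕ} (hp : p.Prime) (hp2 : p ≠ 2) :
    Odd p ∧ ¬(2 : ℤ) ∣ p ∧ ¬(p : ℤ) ∣ 2 := by
  have := hp.odd_of_ne_two hp2
  refine ⟨this, ?_, ?_⟩
  · obtain ⟨k, rfl⟩ := this; omega
  · intro h
    have h : p ∣ 2 := by exact_mod_cast h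
    exact hp2 ((Nat.prime_dvd_prime_iff_eq hp Nat.prime_two).mp h)

theorem symbolProd_neg_one_prime {P : Finset ℕ} (hP : ∀ p ∈ P, p.Prime) (h2 : 2 ∈ P) {r : ℕ}
    (hr : r ∈ P) : symbolProd P (-1) r = 1 := by
  have hrp := hP r hr
  have hsub : ({2, r} : Finset ℕ) ⊆ P := by
    intro x; simp only [Finset.mem_insert, Finset.mem_singleton]; rintro (rfl | rfl) <;> assumption
  rw [symbolProd_eq_prod_subset hsub]
  · have hreal : realSymbol (-1) r = 1 := by
      simp [realSymbol, signSymbol, Int.sign_eq_one_of_pos (Int.natCast_pos.mpr hrp.pos)]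
    rw [symbolProd, hreal, one_mul]
    by_cases hr2 : r = 2
    · subst hr2
      obtain ⟨h3, h4⟩ := padicValInt_unitPart_self Nat.prime_two
      obtain ⟨h5, h6⟩ := padicValInt_unitPart_of_not_dvd (u := -1) Nat.prime_two (by norm_num)
      rw [show ({2, 2} : Finset ℕ) = {2} by simp, Finset.prod_singleton, primeSymbol, if_pos rfl,
        h3, h4, h5, h6]
      decide
    · obtain ⟨ho, hd, hd'⟩ := odd_prime_facts hrp hr2
      rw [Finset.prod_pair (Ne.symm hr2), primeSymbol_two_of_odd (by norm_num) hd,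
        primeSymbol_comm r]
      have := primeSymbol_pow_mul_unit hrp hr2 (β := -1) 1 (u := 1)
        (Nat.prime_iff_prime_int.mp hrp).not_dvd_one (not_dvd_neg_one hrp)
      simp only [pow_one, mul_one] at this
      have h4 : ZMod.χ₄ ((-1 : ℤ) : ZMod 4) = -1 := by decide
      rw [this, jacobiSym.at_neg_one ho, h4, signSymbol_neg_one_left (chi_four_eq_or hd)]
      have := chi_four_eq_or hd
      simp only [Int.cast_natCast] at this ⊢
      rcases this with h | h <;> simp [h]
  · intro p hp hpn
    simp only [Finset.mem_insert, Finset.mem_singleton, not_or] at hpn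
    apply primeSymbol_of_not_dvd (hP p hp) hpn.1 (not_dvd_neg_one (hP p hp))
    intro h
    exact hpn.2 ((Nat.prime_dvd_prime_iff_eq (hP p hp) hrp).mp (by exact_mod_cast h))

theorem symbolProd_neg_one_neg_one {P : Finset ℕ} (hP : ∀ p ∈ P, p.Prime) (h2 : 2 ∈ P) :
    symbolProd P (-1) (-1) = 1 := by
  have hsub : ({2} : Finset ℕ) ⊆ P := by simpa using h2
  rw [symbolProd_eq_prod_subset hsub]
  · rw [symbolProd, Finset.prod_singleton, primeSymbol_two_of_odd (by norm_num) (by norm_num)]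
    decide
  · intro p hp hpn
    simp only [Finset.mem_singleton] at hpn
    exact primeSymbol_of_not_dvd (hP p hp) hpn (not_dvd_neg_one (hP p hp))
      (not_dvd_neg_one (hP p hp))

theorem symbolProd_prime_prime {P : Finset ℕ} (hP : ∀ p ∈ P, p.Prime) (h2 : 2 ∈ P) {r s : ℕ}
    (hr : r ∈ P) (hs : s ∈ P) : symbolProd P r s = 1 := by
  have hrp := hP r hr
  have hsp := hP s hs
  have hreal : realSymbol r s = 1 := by
    simp [realSymbol, signSymbol, Int.sign_eq_one_of_pos (Int.natCast_pos.mpr hrp.pos)]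
  have hndvd : ∀ {x y : ℕ}, x.Prime → y.Prime → x ≠ y → ¬(x : ℤ) ∣ y := by
    intro x y hx hy hxy h
    exact hxy ((Nat.prime_dvd_prime_iff_eq hx hy).mp (by exact_mod_cast h))
  have hsub : ({2, r, s} : Finset ℕ) ⊆ P := by
    intro x; simp only [Finset.mem_insert, Finset.mem_singleton]
    rintro (rfl | rfl | rfl) <;> assumption
  rw [symbolProd_eq_prod_subset hsub]
  swap
  · intro p hp hpn
    simp only [Finset.mem_insert, Finset.mem_singleton, not_or] at hpn
    exact primeSymbol_of_not_dvd (hP p hp) hpn.1 (hndvd (hP p hp) hrp hpn.2.1)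
      (hndvd (hP p hp) hsp hpn.2.2)
  rw [symbolProd, hreal, one_mul]
  have hself : ∀ {x y : ℕ}, x.Prime → y.Prime → x ≠ 2 → x ≠ y →
      primeSymbol x x y = J(y | x) := by
    intro x y hx hy hx2 hxy
    have := primeSymbol_pow_mul_unit hx hx2 (β := y) 1 (u := 1)
        (Nat.prime_iff_prime_int.mp hx).not_dvd_one (hndvd hx hy hxy)
    simpa only [pow_one, mul_one] using this
  have htwo : ∀ {x : ℕ}, x.Prime → x ≠ 2 →
      primeSymbol 2 (2 : ℕ) x * primeSymbol x (2 : ℕ) x = 1 := by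
    intro x hx hx2
    obtain ⟨ho, hd, hd'⟩ := odd_prime_facts hx hx2
    obtain ⟨h3, h4⟩ := padicValInt_unitPart_self Nat.prime_two
    obtain ⟨h5, h6⟩ := padicValInt_unitPart_of_not_dvd (u := x) Nat.prime_two hd
    rw [primeSymbol_comm x, hself hx Nat.prime_two hx2 hx2]
    have h := jacobiSym.at_two ho
    have h8 := chi_eight_eq_or hd
    simp only [Int.cast_natCast] at h8
    have h41 : ZMod.χ₄ ((1 : ℤ) : ZMod 4) = 1 := by decide
    have h81 : ZMod.χ₈ ((1 : ℤ) : ZMod 8) = 1 := by decide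
    rw [primeSymbol, if_pos rfl, h3, h4, h5, h6, Nat.cast_two, h, h41, h81, signSymbol_one_left,
      Int.cast_natCast]
    rcases h8 with h | h <;> simp [h]
  by_cases hrs : r = s
  · subst hrs
    by_cases hr2 : r = 2
    · subst hr2
      obtain ⟨h3, h4⟩ := padicValInt_unitPart_self Nat.prime_two
      rw [show ({2, 2, 2} : Finset ℕ) = {2} by simp, Finset.prod_singleton, primeSymbol,
        if_pos rfl, h3, h4]
      decide
    · obtain ⟨ho, hd, hd'⟩ := odd_prime_facts hrp hr2
      obtain ⟨h3, h4⟩ := padicValInt_unitPart_self hrp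
      have h := chi_four_eq_or hd
      rw [show ({2, r, r} : Finset ℕ) = {2, r} by simp, Finset.prod_pair (Ne.symm hr2),
        primeSymbol_two_of_odd hd hd, signSymbol_self h, primeSymbol, if_neg hr2, h3, h4,
        jacobiSym.at_neg_one ho, jacobiSym.one_left]
      simp only [Int.cast_natCast] at h ⊢
      rcases h with h | h <;> simp [h]
  · by_cases hr2 : r = 2
    · subst hr2
      rw [show ({2, 2, s} : Finset ℕ) = {2, s} by simp, Finset.prod_pair hrs]
      exact htwo hsp (Ne.symm hrs)
    · by_cases hs2 : s = 2
      · subst hs2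
        rw [show ({2, r, 2} : Finset ℕ) = {2, r} by ext; simp; tauto,
          Finset.prod_pair (Ne.symm hr2), primeSymbol_comm 2, primeSymbol_comm r]
        exact htwo hrp hr2
      · obtain ⟨hro, hrd, -⟩ := odd_prime_facts hrp hr2
        obtain ⟨hso, hsd, -⟩ := odd_prime_facts hsp hs2
        rw [Finset.prod_insert (by simp; tauto), Finset.prod_pair hrs,
          primeSymbol_two_of_odd hrd hsd, hself hrp hsp hr2 hrs, primeSymbol_comm s,
          hself hsp hrp hs2 (Ne.symm hrs), jacobiSym.quadratic_reciprocity' hro hso]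
        have hj := jacobiSym_eq_or hrp (hndvd hrp hsp hrs)
        have h3 := chi_four_eq_or hrd
        have h4 := chi_four_eq_or hsd
        simp only [Int.cast_natCast] at h3 h4 ⊢
        have hm1 : J(-1 | r) = ZMod.χ₄ r := jacobiSym.at_neg_one hro
        rw [qrSign]
        rcases h4 with h4 | h4 <;> rw [h4]
        · rw [signSymbol_comm, signSymbol_one_left, jacobiSym.one_left]
          rcases hj with hj | hj <;> rw [hj] <;> simp
        · rw [hm1, signSymbol_comm, signSymbol_neg_one_left h3]
          rcases h3 with h3 | h3 <;> rw [h3] <;> rcases hj with hj | hj <;> rw [hj] <;> simp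

/-- Induction principle for nonzero integers all of whose prime factors lie in `P`. -/
theorem int_induction_of_primes {P : Finset ℕ} {C : ℤ → Prop} (h1 : C 1) (hm1 : C (-1))
    (hp : ∀ p ∈ P, p.Prime → C p) (hmul : ∀ x y : ℤ, x ≠ 0 → y ≠ 0 → C x → C y → C (x * y))
    (α : ℤ) (hα : α ≠ 0) (h : ∀ p : ℕ, p.Prime → (p : ℤ) ∣ α → p ∈ P) : C α := by
  have key : ∀ n : ℕ, n ≠ 0 → (∀ p : ℕ, p.Prime → p ∣ n → p ∈ P) → C n := by
    intro n
    induction n using Nat.recOnMul with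
    | zero => simp
    | one => intros; simpa using h1
    | prime p hpp => intro _ h; exact hp p (h p hpp dvd_rfl) hpp
    | mul a b iha ihb =>
      intro h0 h
      have ha : a ≠ 0 := by rintro rfl; simp at h0
      have hb : b ≠ 0 := by rintro rfl; simp at h0
      push_cast
      exact hmul _ _ (by exact_mod_cast ha) (by exact_mod_cast hb)
        (iha ha fun p hp hd => h p hp (hd.mul_right _)) (ihb hb fun p hp hd => h p hp (hd.mul_left _))
  have hn := key α.natAbs (by simpa using hα) fun p hp hd => h p hp (Int.natCast_dvd.mpr hd)
  rcases Int.natAbs_eq α with e | e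
  · rw [e]; exact hn
  · rw [e, neg_eq_neg_one_mul]
    exact hmul _ _ (by norm_num) (by simpa using hα) hm1 hn

/-- Hilbert reciprocity for the explicit symbols. -/
theorem symbolProd_eq_one {P : Finset ℕ} (hP : ∀ p ∈ P, p.Prime) (h2 : 2 ∈ P) {α β : ℤ}
    (hα : α ≠ 0) (hβ : β ≠ 0) (hαP : ∀ p : ℕ, p.Prime → (p : ℤ) ∣ α → p ∈ P)
    (hβP : ∀ p : ℕ, p.Prime → (p : ℤ) ∣ β → p ∈ P) : symbolProd P α β = 1 := by
  have hone : ∀ β : ℤ, symbolProd P (-1) β = 1 → symbolProd P 1 β = 1 := by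
    intro β h
    have := symbolProd_mul_left hP (α := -1) (α' := -1) (by norm_num) (by norm_num) β
    simpa [h] using this
  have hmul : ∀ β x y : ℤ, x ≠ 0 → y ≠ 0 → symbolProd P x β = 1 → symbolProd P y β = 1 →
      symbolProd P (x * y) β = 1 := by
    intro β x y hx hy h1 h2
    rw [symbolProd_mul_left hP hx hy, h1, h2, one_mul]
  have hneg : ∀ β : ℤ, β ≠ 0 → (∀ p : ℕ, p.Prime → (p : ℤ) ∣ β → p ∈ P) →
      symbolProd P (-1) β = 1 := by
    intro β hβ hβP
    rw [symbolProd_comm]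
    refine int_induction_of_primes (C := fun x => symbolProd P x (-1) = 1) ?_ ?_ ?_ (hmul _)
      β hβ hβP
    · exact hone _ (symbolProd_neg_one_neg_one hP h2)
    · exact symbolProd_neg_one_neg_one hP h2
    · intro p hp _
      rw [symbolProd_comm]
      exact symbolProd_neg_one_prime hP h2 hp
  refine int_induction_of_primes (C := fun x => symbolProd P x β = 1) (hone _ (hneg β hβ hβP))
    (hneg β hβ hβP) ?_ (hmul _) α hα hαP
  intro r hr _
  rw [symbolProd_comm]
  have h1 := symbolProd_neg_one_prime hP h2 hr
  refine int_induction_of_primes (C := fun x => symbolProd P x r = 1) (hone _ h1) h1 ?_ (hmul _)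
    β hβ hβP
  intro s hs _
  exact symbolProd_prime_prime hP h2 hs hr

section Conic

variable {K : Type*} [Field K]

/-- The conic `z² = αx² + βy²` has a point over `K`. -/
def ConicSolvable (α β : K) : Prop :=
  ∃ x y z : K, ¬(x = 0 ∧ y = 0 ∧ z = 0) ∧ z ^ 2 = α * x ^ 2 + β * y ^ 2

theorem ConicSolvable.symm {α β : K} (h : ConicSolvable α β) : ConicSolvable β α := by
  obtain ⟨x, y, z, h0, h⟩ := h
  exact ⟨y, x, z, by tauto, by rw [h]; ring⟩

theorem conicSolvable_comm {α β : K} : ConicSolvable α β ↔ ConicSolvable β α :=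
  ⟨.symm, .symm⟩

theorem conicSolvable_of_sq_left {α β t : K} (h : α = t ^ 2) : ConicSolvable α β :=
  ⟨1, 0, t, by simp, by rw [h]; ring⟩

theorem conicSolvable_of_sq_right {α β t : K} (h : β = t ^ 2) : ConicSolvable α β :=
  ⟨0, 1, t, by simp, by rw [h]; ring⟩

/-- A conic with a point has a point with `y ≠ 0`, or `α` is a square. -/
theorem ConicSolvable.exists_norm {α β : K} (h : ConicSolvable α β) :
    (∃ t, α = t ^ 2) ∨ ∃ z x, β = z ^ 2 - α * x ^ 2 := by
  obtain ⟨x, y, z, h0, h⟩ := h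
  by_cases hy : y = 0
  · subst hy
    have hx : x ≠ 0 := by
      rintro rfl
      simp at h0 h
      exact h0 h
    left
    refine ⟨z / x, ?_⟩
    field_simp
    linear_combination -h
  · right
    refine ⟨z / y, x / y, ?_⟩
    field_simp
    linear_combination -h

theorem conicSolvable_of_norm {α β z x : K} (h : β = z ^ 2 - α * x ^ 2) : ConicSolvable α β :=
  ⟨x, 1, z, by simp, by rw [h]; ring⟩

/-- Multiplying `β` by a norm from `K(√α)` preserves solvability. -/
theorem ConicSolvable.mul_norm {α β c s r : K} (h : ConicSolvable α β)
    (hc : c = s ^ 2 - α * r ^ 2) : ConicSolvable α (β * c) := by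
  rcases h.exists_norm with ⟨t, ht⟩ | ⟨z, x, hzx⟩
  · exact conicSolvable_of_sq_left ht
  · exact conicSolvable_of_norm (z := s * z + α * r * x) (x := s * x + r * z)
      (by rw [hzx, hc]; ring)

theorem ConicSolvable.mul_sq {α β : K} (h : ConicSolvable α β) (c : K) :
    ConicSolvable α (β * c ^ 2) :=
  h.mul_norm (s := c) (r := 0) (by ring)

theorem conicSolvable_mul_sq_iff {α β c : K} (hc : c ≠ 0) :
    ConicSolvable α (β * c ^ 2) ↔ ConicSolvable α β := by
  refine ⟨fun h => ?_, fun h => h.mul_sq c⟩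
  have := h.mul_sq c⁻¹
  rwa [mul_assoc, ← mul_pow, mul_inv_cancel₀ hc, one_pow, mul_one] at this

theorem conicSolvable_sq_mul_iff {α β c : K} (hc : c ≠ 0) :
    ConicSolvable (α * c ^ 2) β ↔ ConicSolvable α β := by
  rw [conicSolvable_comm, conicSolvable_mul_sq_iff hc, conicSolvable_comm]

theorem ConicSolvable.neg_mul {α β : K} (h : ConicSolvable α β) : ConicSolvable α (-α * β) := by
  rw [mul_comm]
  exact h.mul_norm (s := 0) (r := 1) (by ring)

theorem conicSolvable_neg_mul_iff {α β : K} (hα : α ≠ 0) :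
    ConicSolvable α (-α * β) ↔ ConicSolvable α β := by
  refine ⟨fun h => ?_, fun h => h.neg_mul⟩
  have := h.neg_mul
  rwa [show -α * (-α * β) = β * α ^ 2 by ring, conicSolvable_mul_sq_iff hα] at this

theorem ConicSolvable.map {L : Type*} [Field L] (f : K →+* L) {α β : K} (h : ConicSolvable α β) :
    ConicSolvable (f α) (f β) := by
  obtain ⟨x, y, z, h0, h⟩ := h
  refine ⟨f x, f y, f z, ?_, ?_⟩
  · simpa using h0
  · rw [← map_pow, h]; simp

end Conic

theorem hilbertQp_eq_one_iff {p : ℕ} [hp : Fact p.Prime] {α β : ℚ} :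
    hilbertQp p α β = 1 ↔ ConicSolvable (α : ℚ_[p]) (β : ℚ_[p]) := by
  rw [hilbertQp, dif_pos hp.out]
  change (if ConicSolvable (α : ℚ_[p]) (β : ℚ_[p]) then (1 : ℤ) else -1) = 1 ↔ _
  split_ifs with h <;> simp [h]

theorem hilbertQp_eq_or (p : ℕ) (α β : ℚ) : hilbertQp p α β = 1 ∨ hilbertQp p α β = -1 := by
  unfold hilbertQp; split_ifs <;> simp

theorem hilbertR_eq_one_iff {α β : ℚ} :
    hilbertR α β = 1 ↔ ConicSolvable (α : ℝ) (β : ℝ) := by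
  rw [hilbertR]
  change (if ConicSolvable (α : ℝ) (β : ℝ) then (1 : ℤ) else -1) = 1 ↔ _
  split_ifs with h <;> simp [h]

theorem hilbertR_eq_or (α β : ℚ) : hilbertR α β = 1 ∨ hilbertR α β = -1 := by
  unfold hilbertR; split_ifs <;> simp

theorem isSquareQp_iff {p : ℕ} [hp : Fact p.Prime] {d : ℚ} :
    IsSquareQp p d ↔ ∃ t : ℚ_[p], (d : ℚ_[p]) = t ^ 2 := by
  rw [IsSquareQp, dif_pos hp.out]

theorem realSymbol_eq_one_iff {α : ℤ} (hα : α ≠ 0) (β : ℤ) :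
    realSymbol α β = 1 ↔ ConicSolvable (α : ℝ) (β : ℝ) := by
  simp only [realSymbol, signSymbol, Int.sign_eq_neg_one_iff_neg]
  split_ifs with h
  · refine ⟨fun h => by norm_num at h, ?_⟩
    rintro ⟨x, y, z, h0, e⟩
    exfalso
    have h1 : (α : ℝ) < 0 := by exact_mod_cast h.1
    have h2 : (β : ℝ) < 0 := by exact_mod_cast h.2
    apply h0
    have hx := sq_nonneg x
    have hy := sq_nonneg y
    have hz := sq_nonneg z
    have e1 : x ^ 2 = 0 := by nlinarith
    have e2 : y ^ 2 = 0 := by nlinarith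
    have e3 : z ^ 2 = 0 := by rw [e, e1, e2]; ring
    exact ⟨pow_eq_zero_iff two_ne_zero |>.mp e1, pow_eq_zero_iff two_ne_zero |>.mp e2,
      pow_eq_zero_iff two_ne_zero |>.mp e3⟩
  · refine ⟨fun _ => ?_, fun _ => rfl⟩
    rcases lt_or_gt_of_ne hα with h1 | h1
    · have h2 : (0 : ℝ) ≤ β := by
        have : ¬β < 0 := fun hb => h ⟨h1, hb⟩
        exact_mod_cast not_lt.mp this
      exact conicSolvable_of_sq_right (Real.sq_sqrt h2).symm
    · have h2 : (0 : ℝ) ≤ α := by exact_mod_cast h1.le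
      exact conicSolvable_of_sq_left (Real.sq_sqrt h2).symm

/-- A conic with `p`-integral coefficients and a `p`-adic point has a primitive point. -/
theorem ConicSolvable.exists_primitive {p : ℕ} [hp : Fact p.Prime] {α β : ℤ}
    (h : ConicSolvable (α : ℚ_[p]) (β : ℚ_[p])) :
    ∃ x y z : ℤ_[p], (IsUnit x ∨ IsUnit y ∨ IsUnit z) ∧ z ^ 2 = α * x ^ 2 + β * y ^ 2 := by
  obtain ⟨x, y, z, h0, h⟩ := h
  obtain ⟨m, hm0, hx, hy, hz, hm⟩ : ∃ m : ℚ_[p], m ≠ 0 ∧ ‖x‖ ≤ ‖m‖ ∧ ‖y‖ ≤ ‖m‖ ∧ ‖z‖ ≤ ‖m‖ ∧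
      (m = x ∨ m = y ∨ m = z) := by
    rcases le_total ‖x‖ ‖y‖ with h1 | h1 <;> rcases le_total ‖y‖ ‖z‖ with h2 | h2 <;>
      rcases le_total ‖x‖ ‖z‖ with h3 | h3
    all_goals
      first
      | (refine ⟨x, ?_, le_rfl, by linarith, by linarith, by simp⟩; rintro rfl)
      | (refine ⟨y, ?_, by linarith, le_rfl, by linarith, by simp⟩; rintro rfl)
      | (refine ⟨z, ?_, by linarith, by linarith, le_rfl, by simp⟩; rintro rfl)
      simp only [norm_zero, norm_le_zero_iff] at h1 h2 h3
      simp_all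
  have hb : ∀ w : ℚ_[p], ‖w‖ ≤ ‖m‖ → ‖w / m‖ ≤ 1 := by
    intro w hw
    rw [norm_div]
    exact div_le_one_of_le₀ hw (norm_nonneg _)
  have hlift : ∀ w : ℚ_[p], ‖w‖ ≤ ‖m‖ → ∃ w' : ℤ_[p], (w' : ℚ_[p]) = w / m :=
    fun w hw => ⟨⟨w / m, hb w hw⟩, rfl⟩
  obtain ⟨x', hx'⟩ := hlift x hx
  obtain ⟨y', hy'⟩ := hlift y hy
  obtain ⟨z', hz'⟩ := hlift z hz
  refine ⟨x', y', z', ?_, ?_⟩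
  · rw [PadicInt.isUnit_iff, PadicInt.isUnit_iff, PadicInt.isUnit_iff, PadicInt.norm_def,
      PadicInt.norm_def, PadicInt.norm_def, hx', hy', hz']
    rcases hm with rfl | rfl | rfl
    · left; simp [hm0]
    · right; left; simp [hm0]
    · right; right; simp [hm0]
  · apply Subtype.ext
    push_cast
    rw [hx', hy', hz']
    field_simp
    exact h

theorem padicInt_isUnit_intCast {p : ℕ} [hp : Fact p.Prime] {u : ℤ} :
    IsUnit (u : ℤ_[p]) ↔ ¬(p : ℤ) ∣ u := by
  rw [PadicInt.isUnit_iff, ← PadicInt.norm_int_lt_one_iff_dvd]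
  have := PadicInt.norm_le_one (u : ℤ_[p])
  constructor
  · intro h; rw [h]; exact lt_irrefl _
  · intro h; exact le_antisymm this (not_lt.mp h)

open Polynomial in
/-- Hensel's lemma for square roots. -/
theorem padicInt_exists_sq {p : ℕ} [hp : Fact p.Prime] {m r : ℤ_[p]}
    (h : ‖r ^ 2 - m‖ < ‖2 * r‖ ^ 2) : ∃ t : ℤ_[p], m = t ^ 2 := by
  obtain ⟨t, ht, -⟩ := hensels_lemma (F := (X ^ 2 - C m : ℤ_[p][X])) (a := r)
    (by simpa [← two_mul, one_add_one_eq_two] using h)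
  exact ⟨t, by simpa [sub_eq_zero, eq_comm] using ht⟩

theorem padicInt_sq_of_jacobiSym {p : ℕ} [hp : Fact p.Prime] (hp2 : p ≠ 2) {u : ℤ}
    (h : J(u | p) = 1) : ∃ t : ℤ_[p], (u : ℤ_[p]) = t ^ 2 := by
  have hu : ¬(p : ℤ) ∣ u := by
    intro hd
    rw [← jacobiSym.legendreSym.to_jacobiSym, (legendreSym.eq_zero_iff p u).mpr
      ((ZMod.intCast_zmod_eq_zero_iff_dvd u p).mpr hd)] at h
    norm_num at h
  obtain ⟨r, hr⟩ := ZMod.isSquare_of_jacobiSym_eq_one h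
  obtain ⟨r, rfl⟩ := ZMod.intCast_surjective r
  have hd : (p : ℤ) ∣ r ^ 2 - u := by
    rw [← ZMod.intCast_zmod_eq_zero_iff_dvd]
    push_cast
    rw [hr]; ring
  have hr' : ¬(p : ℤ) ∣ 2 * r := by
    apply not_dvd_mul hp.out (odd_prime_facts hp.out hp2).2.2
    intro h
    apply hu
    have := (h.mul_left r).sub hd
    simpa [sq] using this
  apply padicInt_exists_sq (r := r)
  have h1 : ‖((r ^ 2 - u : ℤ) : ℤ_[p])‖ < 1 := PadicInt.norm_int_lt_one_iff_dvd _ |>.mpr hd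
  have h2 : ‖((2 * r : ℤ) : ℤ_[p])‖ = 1 := PadicInt.isUnit_iff.mp (padicInt_isUnit_intCast.mpr hr')
  push_cast at h1 h2
  rw [h2]
  simpa using h1

theorem padicInt_two_sq {u : ℤ} (h : u % 8 = 1) : ∃ t : ℤ_[2], (u : ℤ_[2]) = t ^ 2 := by
  apply padicInt_exists_sq (r := 1)
  have h1 : ‖((1 - u : ℤ) : ℤ_[2])‖ ≤ (2 : ℕ) ^ (-(3 : ℕ) : ℤ) := by
    rw [PadicInt.norm_int_le_pow_iff_dvd]
    norm_num
    omega
  have h2 : ‖(2 : ℤ_[2])‖ = (2 : ℝ)⁻¹ := by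
    have := PadicInt.norm_p (p := 2)
    simpa using this
  push_cast at h1
  rw [one_pow, mul_one, h2]
  refine h1.trans_lt ?_
  norm_num

theorem conicSolvable_of_padicInt_sq {p : ℕ} [hp : Fact p.Prime] {α β : ℤ}
    (h : ∃ t : ℤ_[p], (α : ℤ_[p]) = t ^ 2) : ConicSolvable (α : ℚ_[p]) (β : ℚ_[p]) := by
  obtain ⟨t, ht⟩ := h
  refine conicSolvable_of_sq_left (t := (t : ℚ_[p])) ?_
  have := congrArg (fun x : ℤ_[p] => (x : ℚ_[p])) ht
  simpa using this

theorem jacobiSym_eq_one_of_sq {p : ℕ} [hp : Fact p.Prime] {u : ℤ} {z : ZMod p} (hz : z ≠ 0)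
    (h : (u : ZMod p) = z ^ 2) : J(u | p) = 1 := by
  rw [← jacobiSym.legendreSym.to_jacobiSym, legendreSym.eq_one_iff, h, sq]
  · exact ⟨z, rfl⟩
  · rw [h]
    exact pow_ne_zero _ hz

theorem conicSolvable_of_units {p : ℕ} [hp : Fact p.Prime] (hp2 : p ≠ 2) {u v : ℤ}
    (hu : ¬(p : ℤ) ∣ u) (hv : ¬(p : ℤ) ∣ v) : ConicSolvable (u : ℚ_[p]) (v : ℚ_[p]) := by
  have hu' : (u : ZMod p) ≠ 0 := by rwa [Ne, ZMod.intCast_zmod_eq_zero_iff_dvd]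
  have hv' : (v : ZMod p) ≠ 0 := by rwa [Ne, ZMod.intCast_zmod_eq_zero_iff_dvd]
  obtain ⟨x, z, h⟩ : ∃ x z : ZMod p, u * x ^ 2 + v = z ^ 2 := by
    obtain ⟨x, z, h⟩ := FiniteField.exists_root_sum_quadratic
      (f := (Polynomial.C (u : ZMod p) * Polynomial.X ^ 2 + Polynomial.C (v : ZMod p)))
      (g := (-Polynomial.X ^ 2 : Polynomial (ZMod p)))
      (by compute_degree!) (by rw [Polynomial.degree_neg]; exact Polynomial.degree_X_pow 2)
      (by rw [ZMod.card]; exact (odd_prime_facts hp.out hp2).1 |> Nat.odd_iff.mp)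
    refine ⟨x, z, ?_⟩
    simp at h
    linear_combination h
  obtain ⟨x, rfl⟩ := ZMod.intCast_surjective x
  by_cases hz : z = 0
  · subst hz
    have hJ : J(-u * v | p) = 1 := by
      refine jacobiSym_eq_one_of_sq (z := u * x) ?_ ?_
      · refine mul_ne_zero hu' ?_
        intro hx
        rw [hx] at h
        exact hv' (by simpa using h)
      · push_cast
        linear_combination -(u : ZMod p) * h
    have := conicSolvable_of_padicInt_sq (β := u) (padicInt_sq_of_jacobiSym hp2 hJ)
    push_cast at this
    refine (conicSolvable_neg_mul_iff ?_).mp this.symm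
    rintro h0
    apply hu
    rw [Int.cast_eq_zero.mp h0]
    exact dvd_zero _
  · have hJ : J(u * x ^ 2 + v | p) = 1 :=
      jacobiSym_eq_one_of_sq hz (by push_cast; exact h)
    obtain ⟨t, ht⟩ := padicInt_sq_of_jacobiSym hp2 hJ
    refine ⟨x, 1, t, by simp, ?_⟩
    have := congrArg (fun x : ℤ_[p] => (x : ℚ_[p])) ht
    simp at this
    rw [← this]
    ring

theorem exists_intCast_eq_toZMod {p : ℕ} [hp : Fact p.Prime] {α β : ℤ} (hα : (p : ℤ) ∣ β)
    (hβ : ¬ (p : ℤ) ^ 2 ∣ β) (h : ConicSolvable (α : ℚ_[p]) (β : ℚ_[p])) :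
    ∃ w : ZMod p, (α : ZMod p) = w ^ 2 := by
  obtain ⟨x, y, z, h0, h⟩ := h.exists_primitive
  obtain ⟨v, rfl⟩ := hα
  have hv : ¬(p : ℤ) ∣ v := fun hd => hβ (by rw [sq]; exact mul_dvd_mul_left _ hd)
  have hz := congrArg (PadicInt.toZMod (p := p)) h
  simp at hz
  have hmem : ∀ w : ℤ_[p], PadicInt.toZMod w = 0 → (p : ℤ_[p]) ∣ w := by
    intro w hw
    rw [← RingHom.mem_ker, PadicInt.ker_toZMod, PadicInt.maximalIdeal_eq_span_p,
      Ideal.mem_span_singleton] at hw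
    exact hw
  have hunit : ∀ w : ℤ_[p], (p : ℤ_[p]) ∣ w → ¬ IsUnit w := fun w hw hu =>
    PadicInt.prime_p.not_isUnit (isUnit_of_dvd_unit hw hu)
  by_cases hx : PadicInt.toZMod x = 0
  · exfalso
    rw [hx] at hz
    have hz0 : PadicInt.toZMod z = 0 := by simpa using hz
    obtain ⟨x', rfl⟩ := hmem x hx
    obtain ⟨z', rfl⟩ := hmem z hz0
    have hp0 : (p : ℤ_[p]) ≠ 0 := PadicInt.prime_p.ne_zero
    have e : (v : ℤ_[p]) * y ^ 2 = p * (z' ^ 2 - α * x' ^ 2) := by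
      apply mul_left_cancel₀ hp0
      push_cast at h
      linear_combination -h
    have hy : (p : ℤ_[p]) ∣ v * y ^ 2 := ⟨_, e⟩
    rcases PadicInt.prime_p.dvd_or_dvd hy with h1 | h1
    · exact hunit _ h1 (padicInt_isUnit_intCast.mpr hv)
    · have := PadicInt.prime_p.dvd_of_dvd_pow h1
      rcases h0 with h0 | h0 | h0
      · exact hunit _ (dvd_mul_right _ _) h0
      · exact hunit _ this h0
      · exact hunit _ (dvd_mul_right _ _) h0
  · refine ⟨PadicInt.toZMod z / PadicInt.toZMod x, ?_⟩
    field_simp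
    exact hz.symm

theorem conicSolvable_unit_uniformizer {p : ℕ} [hp : Fact p.Prime] (hp2 : p ≠ 2) {u v : ℤ}
    (hu : ¬(p : ℤ) ∣ u) (hv : ¬(p : ℤ) ∣ v) :
    ConicSolvable (u : ℚ_[p]) ((p * v : ℤ) : ℚ_[p]) ↔ J(u | p) = 1 := by
  refine ⟨fun h => ?_, fun h => conicSolvable_of_padicInt_sq (padicInt_sq_of_jacobiSym hp2 h)⟩
  have hu' : (u : ZMod p) ≠ 0 := by rwa [Ne, ZMod.intCast_zmod_eq_zero_iff_dvd]
  obtain ⟨w, hw⟩ := exists_intCast_eq_toZMod (dvd_mul_right _ _) (fun hd => hv (by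
    rw [sq] at hd
    exact Int.dvd_of_mul_dvd_mul_left (by exact_mod_cast hp.out.ne_zero) hd)) h
  refine jacobiSym_eq_one_of_sq (z := w) ?_ hw
  rintro rfl
  exact hu' (by simpa using hw)

/-- At an odd prime the explicit symbol detects solvability. -/
theorem primeSymbol_eq_one_iff_of_odd {p : ℕ} [hp : Fact p.Prime] (hp2 : p ≠ 2) {α β : ℤ}
    (hα : α ≠ 0) (hβ : β ≠ 0) :
    primeSymbol p α β = 1 ↔ ConicSolvable (α : ℚ_[p]) (β : ℚ_[p]) := by
  have hp0 : (p : ℚ_[p]) ≠ 0 := by exact_mod_cast hp.out.ne_zero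
  have hu := not_dvd_unitPart hp.out hα
  have hv := not_dvd_unitPart hp.out hβ
  have eα := congrArg (fun x : ℤ => (x : ℚ_[p])) (eq_pow_mul_unitPart p α)
  have eβ := congrArg (fun x : ℤ => (x : ℚ_[p])) (eq_pow_mul_unitPart p β)
  have hJu := jacobiSym_eq_or hp.out hu
  have hJv := jacobiSym_eq_or hp.out hv
  have hJm := jacobiSym_eq_or hp.out (not_dvd_neg_one hp.out)
  rw [primeSymbol, if_neg hp2]
  generalize unitPart p α = u at *
  generalize unitPart p β = v at *
  generalize padicValInt p α = i at *
  generalize padicValInt p β = j at *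
  rw [eα, eβ]
  push_cast
  have hu0 : (u : ℚ_[p]) ≠ 0 := by
    intro h; apply hu; rw [Int.cast_eq_zero.mp h]; exact dvd_zero _
  have one_iff : ∀ {x : ℤ}, (x = 1 ∨ x = -1) → ∀ k, (x ^ (2 * k) = 1) := by
    rintro x (rfl | rfl) k <;> simp
  have key : ∀ {k l : ℕ} {x y : ℚ_[p]}, ConicSolvable ((p : ℚ_[p]) ^ (2 * k) * x)
      ((p : ℚ_[p]) ^ (2 * l) * y) ↔ ConicSolvable x y := by
    intro k l x y
    rw [mul_comm 2 k, mul_comm 2 l, pow_mul, pow_mul, mul_comm _ x, mul_comm _ y,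
      conicSolvable_mul_sq_iff (pow_ne_zero _ hp0), conicSolvable_sq_mul_iff (pow_ne_zero _ hp0)]
  rcases Nat.even_or_odd' i with ⟨k, rfl | rfl⟩ <;> rcases Nat.even_or_odd' j with ⟨l, rfl | rfl⟩
  · rw [key, one_iff hJu, one_iff hJv, mul_assoc 2, one_iff hJm]
    simpa using conicSolvable_of_units hp2 hu hv
  · rw [pow_succ (p : ℚ_[p]), mul_assoc _ (p : ℚ_[p]), key, mul_assoc 2, one_iff hJm, one_iff hJv,
      pow_succ, one_iff hJu]
    have := conicSolvable_unit_uniformizer hp2 hu hv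
    push_cast at this
    rw [this]
    simp
  · rw [pow_succ (p : ℚ_[p]), mul_assoc _ (p : ℚ_[p]), key, mul_left_comm _ 2, one_iff hJm,
      one_iff hJu, pow_succ, one_iff hJv]
    have := conicSolvable_unit_uniformizer hp2 hv hu
    push_cast at this
    rw [conicSolvable_comm, this]
    simp
  · rw [pow_succ (p : ℚ_[p]), mul_assoc _ (p : ℚ_[p]), pow_succ (p : ℚ_[p]),
      mul_assoc _ (p : ℚ_[p]), key, ← conicSolvable_neg_mul_iff (mul_ne_zero hp0 hu0),
      show -((p : ℚ_[p]) * u) * (p * v) = -u * v * (p : ℚ_[p]) ^ 2 by ring,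
      conicSolvable_mul_sq_iff hp0, conicSolvable_comm]
    have := conicSolvable_unit_uniformizer hp2 (u := -1 * u * v) (v := u)
      (not_dvd_mul hp.out (not_dvd_mul hp.out (not_dvd_neg_one hp.out) hu) hv) hu
    push_cast at this
    rw [show (-u * v : ℚ_[p]) = -1 * u * v by ring, this, jacobiSym.mul_left, jacobiSym.mul_left,
      show (2 * k + 1) * (2 * l + 1) = 2 * (2 * k * l + k + l) + 1 by ring, pow_succ _ (2 * _),
      one_iff hJm, pow_succ _ (2 * _), one_iff hJu, pow_succ _ (2 * _), one_iff hJv]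
    simp

theorem residue_mod_eight {u : ℤ} (hu : ¬(2 : ℤ) ∣ u) :
    u % 8 ∈ ({1, 3, 5, 7} : Finset ℤ) := by
  simp only [Finset.mem_insert, Finset.mem_singleton]
  omega

theorem ConicSolvable.mod_sixteen {α β : ℤ} (h : ConicSolvable (α : ℚ_[2]) (β : ℚ_[2])) :
    ∃ x ∈ ({0, 1, 4, 9} : Finset (ZMod 16)), ∃ y ∈ ({0, 1, 4, 9} : Finset (ZMod 16)),
      ∃ z ∈ ({0, 1, 4, 9} : Finset (ZMod 16)),
        (x ∈ ({1, 9} : Finset (ZMod 16)) ∨ y ∈ ({1, 9} : Finset (ZMod 16)) ∨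
          z ∈ ({1, 9} : Finset (ZMod 16))) ∧ z = α * x + β * y := by
  obtain ⟨x, y, z, h0, h⟩ := h.exists_primitive
  have e := congrArg (PadicInt.toZModPow (p := 2) 4) h
  have hu : ∀ w : ℤ_[2], IsUnit w → IsUnit (PadicInt.toZModPow 4 w) := fun w hw => hw.map _
  simp only [map_add, map_mul, map_pow, map_intCast] at e
  have hsq : ∀ w : ZMod 16, w ^ 2 ∈ ({0, 1, 4, 9} : Finset (ZMod 16)) := by decide
  have hsq' : ∀ w : ZMod 16, IsUnit w → w ^ 2 ∈ ({1, 9} : Finset (ZMod 16)) := by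
    intro w hw
    have : ∀ w w' : ZMod 16, w * w' = 1 → w ^ 2 ∈ ({1, 9} : Finset (ZMod 16)) := by decide
    obtain ⟨w', hw'⟩ := hw.exists_right_inv
    exact this w w' hw'
  refine ⟨_, hsq (PadicInt.toZModPow 4 x), _, hsq (PadicInt.toZModPow 4 y), _,
    hsq (PadicInt.toZModPow 4 z), ?_, e⟩
  rcases h0 with h0 | h0 | h0
  · exact Or.inl (hsq' _ (hu _ h0))
  · exact Or.inr (Or.inl (hsq' _ (hu _ h0)))
  · exact Or.inr (Or.inr (hsq' _ (hu _ h0)))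

/-- The explicit symbol at `2` of `2 ^ i * u` and `2 ^ j * v`. -/
def twoSymbol (i j : ℕ) (u v : ℤ) : ℤ :=
  signSymbol (ZMod.χ₄ u) (ZMod.χ₄ v) * ZMod.χ₈ u ^ j * ZMod.χ₈ v ^ i

theorem conicSolvable_two_of_small {α β x y : ℤ} {k : ℕ}
    (h : α * x ^ 2 + β * y ^ 2 = 4 ^ k * ((α * x ^ 2 + β * y ^ 2) / 4 ^ k))
    (h8 : (α * x ^ 2 + β * y ^ 2) / 4 ^ k % 8 = 1) (hxy : ¬(x = 0 ∧ y = 0)) :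
    ConicSolvable (α : ℚ_[2]) (β : ℚ_[2]) := by
  obtain ⟨t, ht⟩ := padicInt_two_sq h8
  refine ⟨x, y, 2 ^ k * t, ?_, ?_⟩
  · rintro ⟨hx, hy, -⟩
    exact hxy ⟨Int.cast_eq_zero.mp hx, Int.cast_eq_zero.mp hy⟩
  · have e := congrArg (fun x : ℤ_[2] => (x : ℚ_[2])) ht
    simp only [PadicInt.coe_intCast, PadicInt.coe_pow] at e
    have h' := congrArg (fun x : ℤ => (x : ℚ_[2])) h
    simp only [Int.cast_mul, e] at h'
    push_cast at h'
    rw [h', show (4 : ℚ_[2]) = 2 ^ 2 by norm_num, ← pow_mul]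
    ring

theorem twoSymbol_solution : ∀ i ∈ Finset.range 2, ∀ j ∈ Finset.range 2,
    ∀ u ∈ ({1, 3, 5, 7} : Finset ℤ), ∀ v ∈ ({1, 3, 5, 7} : Finset ℤ), twoSymbol i j u v = 1 →
      ∃ x ∈ ({0, 1, 2, 3} : Finset ℤ), ∃ y ∈ ({0, 1, 2, 3} : Finset ℤ), ∃ k ∈ Finset.range 3,
        ¬(x = 0 ∧ y = 0) ∧
        (2 ^ i * u) * x ^ 2 + (2 ^ j * v) * y ^ 2 =
          4 ^ k * (((2 ^ i * u) * x ^ 2 + (2 ^ j * v) * y ^ 2) / 4 ^ k) ∧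
        ((2 ^ i * u) * x ^ 2 + (2 ^ j * v) * y ^ 2) / 4 ^ k % 8 = 1 := by
  decide

theorem twoSymbol_no_solution : ∀ i ∈ Finset.range 2, ∀ j ∈ Finset.range 2,
    ∀ u ∈ ({1, 3, 5, 7} : Finset ℤ), ∀ v ∈ ({1, 3, 5, 7} : Finset ℤ),
      (∃ x ∈ ({0, 1, 4, 9} : Finset (ZMod 16)), ∃ y ∈ ({0, 1, 4, 9} : Finset (ZMod 16)),
      ∃ z ∈ ({0, 1, 4, 9} : Finset (ZMod 16)),
        (x ∈ ({1, 9} : Finset (ZMod 16)) ∨ y ∈ ({1, 9} : Finset (ZMod 16)) ∨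
          z ∈ ({1, 9} : Finset (ZMod 16))) ∧
        z = (2 ^ i * u : ℤ) * x + (2 ^ j * v : ℤ) * y) → twoSymbol i j u v = 1 := by
  decide

theorem conicSolvable_two_iff_of_residue {i j : ℕ} (hi : i < 2) (hj : j < 2) {u v : ℤ}
    (hu : u ∈ ({1, 3, 5, 7} : Finset ℤ)) (hv : v ∈ ({1, 3, 5, 7} : Finset ℤ)) :
    twoSymbol i j u v = 1 ↔
      ConicSolvable ((2 ^ i * u : ℤ) : ℚ_[2]) ((2 ^ j * v : ℤ) : ℚ_[2]) := by
  constructor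
  · intro h
    obtain ⟨x, -, y, -, k, -, h0, h1, h2⟩ := twoSymbol_solution i (Finset.mem_range.mpr hi) j
      (Finset.mem_range.mpr hj) u hu v hv h
    exact conicSolvable_two_of_small h1 h2 h0
  · intro h
    exact twoSymbol_no_solution i (Finset.mem_range.mpr hi) j
      (Finset.mem_range.mpr hj) u hu v hv h.mod_sixteen

/-- An odd integer agrees with its residue modulo `8` up to a `2`-adic square. -/
theorem exists_sq_mul_residue {u : ℤ} (hu : ¬(2 : ℤ) ∣ u) :
    ∃ t : ℚ_[2], t ≠ 0 ∧ (u : ℚ_[2]) = ((u % 8 : ℤ) : ℚ_[2]) * t ^ 2 := by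
  have hr := residue_mod_eight hu
  have h8 : (u * (u % 8)) % 8 = 1 := by
    rw [Int.mul_emod, Int.emod_emod]
    revert hr
    generalize u % 8 = r
    revert r
    decide
  obtain ⟨t, ht⟩ := padicInt_two_sq h8
  have e := congrArg (fun x : ℤ_[2] => (x : ℚ_[2])) ht
  push_cast at e
  have hu0 : (u : ℚ_[2]) ≠ 0 := by
    intro h; apply hu; rw [Int.cast_eq_zero.mp h]; exact dvd_zero _
  have hr0 : ((u % 8 : ℤ) : ℚ_[2]) ≠ 0 := by
    intro h; rw [Int.cast_eq_zero] at h; omega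
  refine ⟨t / ((u % 8 : ℤ) : ℚ_[2]), div_ne_zero ?_ hr0, ?_⟩
  · intro h
    rw [h] at e
    exact mul_ne_zero hu0 hr0 (by simpa using e)
  · field_simp
    rw [← e]

theorem twoSymbol_mod (i j : ℕ) {u v : ℤ} (hu : ¬(2 : ℤ) ∣ u) (hv : ¬(2 : ℤ) ∣ v) :
    twoSymbol i j u v = twoSymbol (i % 2) (j % 2) (u % 8) (v % 8) := by
  have h4 : ∀ w : ℤ, ZMod.χ₄ ((w % 8 : ℤ) : ZMod 4) = ZMod.χ₄ w := by
    intro w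
    rw [ZMod.χ₄_int_mod_four, ZMod.χ₄_int_mod_four w, Int.emod_emod_of_dvd w (by norm_num)]
  have hpow : ∀ (x : ℤ) (k : ℕ), (x = 1 ∨ x = -1) → x ^ (k % 2) = x ^ k := by
    intro x k hx
    conv_rhs => rw [← Nat.mod_add_div k 2, pow_add, pow_mul]
    rcases hx with rfl | rfl <;> simp
  unfold twoSymbol
  rw [h4, h4, ← ZMod.χ₈_int_mod_eight, ← ZMod.χ₈_int_mod_eight, hpow _ _ (chi_eight_eq_or hu),
    hpow _ _ (chi_eight_eq_or hv)]

/-- At `2` the explicit symbol detects solvability. -/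
theorem primeSymbol_two_eq_one_iff {α β : ℤ} (hα : α ≠ 0) (hβ : β ≠ 0) :
    primeSymbol 2 α β = 1 ↔ ConicSolvable (α : ℚ_[2]) (β : ℚ_[2]) := by
  have hu := not_dvd_unitPart Nat.prime_two hα
  have hv := not_dvd_unitPart Nat.prime_two hβ
  have eα := congrArg (fun x : ℤ => (x : ℚ_[2])) (eq_pow_mul_unitPart 2 α)
  have eβ := congrArg (fun x : ℤ => (x : ℚ_[2])) (eq_pow_mul_unitPart 2 β)
  rw [primeSymbol, if_pos rfl]
  change twoSymbol _ _ _ _ = 1 ↔ _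
  generalize unitPart 2 α = u at *
  generalize unitPart 2 β = v at *
  generalize padicValInt 2 α = i at *
  generalize padicValInt 2 β = j at *
  rw [twoSymbol_mod i j hu hv, conicSolvable_two_iff_of_residue (Nat.mod_lt _ two_pos)
    (Nat.mod_lt _ two_pos) (residue_mod_eight hu) (residue_mod_eight hv), eα, eβ]
  have key : ∀ (k : ℕ) (w : ℤ), ¬(2 : ℤ) ∣ w → ∃ t : ℚ_[2], t ≠ 0 ∧
      (((2 : ℕ) : ℤ) ^ k * w : ℤ) = ((2 ^ (k % 2) * (w % 8) : ℤ) : ℚ_[2]) * t ^ 2 := by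
    intro k w hw
    obtain ⟨t, ht0, ht⟩ := exists_sq_mul_residue hw
    refine ⟨2 ^ (k / 2) * t, mul_ne_zero (pow_ne_zero _ two_ne_zero) ht0, ?_⟩
    rw [Int.cast_mul, ht, Int.cast_mul]
    push_cast
    conv_lhs => rw [← Nat.mod_add_div k 2, pow_add, pow_mul']
    ring
  obtain ⟨t, ht0, ht⟩ := key i u hu
  obtain ⟨s, hs0, hs⟩ := key j v hv
  rw [ht, hs, conicSolvable_mul_sq_iff hs0, conicSolvable_sq_mul_iff ht0]

theorem primeSymbol_eq_one_iff {p : ℕ} [hp : Fact p.Prime] {α β : ℤ} (hα : α ≠ 0) (hβ : β ≠ 0) :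
    primeSymbol p α β = 1 ↔ ConicSolvable (α : ℚ_[p]) (β : ℚ_[p]) := by
  by_cases hp2 : p = 2
  · subst hp2
    exact primeSymbol_two_eq_one_iff hα hβ
  · exact primeSymbol_eq_one_iff_of_odd hp2 hα hβ

theorem exists_sq_sub_dvd_of_squarefree (a : ℤ) (n : ℕ) (hn : Squarefree n)
    (h : ∀ p : ℕ, p.Prime → p ∣ n → ∃ w : ℤ, (p : ℤ) ∣ w ^ 2 - a) :
    ∃ t : ℤ, (n : ℤ) ∣ t ^ 2 - a := by
  induction n using induction_on_primes with
  | zero => exact absurd hn not_squarefree_zero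
  | one => exact ⟨0, by simp⟩
  | prime_mul p m hp ih =>
    obtain ⟨hcop, -, hm⟩ := Nat.squarefree_mul_iff.mp hn
    obtain ⟨t, ht⟩ := ih hm fun r hr hd => h r hr (hd.mul_left _)
    obtain ⟨w, hw⟩ := h p hp (dvd_mul_right _ _)
    obtain ⟨u, v, huv⟩ := Nat.isCoprime_iff_coprime.mpr hcop
    refine ⟨t * (u * p) + w * (v * m), ?_⟩
    push_cast
    refine (Nat.isCoprime_iff_coprime.mpr hcop).mul_dvd ?_ ?_
    · have e : (t * (u * p) + w * (v * m)) ^ 2 - a = (w ^ 2 - a) + p * (u * (t - w) *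
          (2 * w + u * p * (t - w))) := by
        rw [show w * (v * (m : ℤ)) = w * (1 - u * p) by rw [← huv]; ring]
        ring
      rw [e]
      exact dvd_add hw (dvd_mul_right _ _)
    · have e : (t * (u * p) + w * (v * m)) ^ 2 - a = (t ^ 2 - a) + m * (v * (w - t) *
          (2 * t + v * m * (w - t))) := by
        rw [show t * (u * (p : ℤ)) = t * (1 - v * m) by rw [← huv]; ring]
        ring
      rw [e]
      exact dvd_add ht (dvd_mul_right _ _)

/-- Local solvability of a conic at the real place and at the odd primes. -/
def LocallySolvable (a b : ℤ) : Prop :=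
  ConicSolvable (a : ℝ) (b : ℝ) ∧
    ∀ (p : ℕ) [Fact p.Prime], p ≠ 2 → ConicSolvable (a : ℚ_[p]) (b : ℚ_[p])

theorem LocallySolvable.symm {a b : ℤ} (h : LocallySolvable a b) : LocallySolvable b a :=
  ⟨h.1.symm, fun p _ hp2 => (h.2 p hp2).symm⟩

theorem LocallySolvable.transfer {a b b' : ℤ}
    (H : ∀ {K : Type} [Field K] [CharZero K],
      ConicSolvable (a : K) (b : K) → ConicSolvable (a : K) (b' : K))
    (h : LocallySolvable a b) : LocallySolvable a b' :=
  ⟨H h.1, fun p _ hp2 => H (h.2 p hp2)⟩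

/-- Legendre's theorem: a conic over `ℚ` with points over `ℝ` and over `ℚ_p` for odd `p` has a
rational point. -/
theorem LocallySolvable.conicSolvable {a b : ℤ} (ha : a ≠ 0) (hb : b ≠ 0)
    (h : LocallySolvable a b) : ConicSolvable (a : ℚ) (b : ℚ) := by
  obtain ⟨n, hn⟩ : ∃ n : ℕ, a.natAbs + b.natAbs = n := ⟨_, rfl⟩
  induction n using Nat.strong_induction_on generalizing a b with
  | _ n ih =>
    wlog hab : a.natAbs ≤ b.natAbs generalizing a b
    · exact (this hb ha h.symm (by omega) (by omega)).symm
    by_cases hb1 : b.natAbs = 1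
    · have h1 := (realSymbol_eq_one_iff ha b).mpr h.1
      have ha' : a = 1 ∨ a = -1 := by omega
      have hb' : b = 1 ∨ b = -1 := by omega
      rcases ha' with rfl | rfl
      · exact conicSolvable_of_sq_left (t := 1) (by norm_num)
      · rcases hb' with rfl | rfl
        · exact conicSolvable_of_sq_right (t := 1) (by norm_num)
        · exact absurd h1 (by decide)
    have hb2 : 2 ≤ b.natAbs := by omega
    by_cases hsq : Squarefree b
    · obtain ⟨t, ht⟩ := exists_sq_sub_dvd_of_squarefree a b.natAbs
        (Int.squarefree_natAbs.mpr hsq) (by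
          intro p hp hd
          have := Fact.mk hp
          by_cases hp2 : p = 2
          · subst hp2
            refine ⟨a, ?_⟩
            have := Int.even_mul_pred_self a
            rw [show a ^ 2 - a = a * (a - 1) by ring]
            exact this.two_dvd
          · have hd' : (p : ℤ) ∣ b := Int.natCast_dvd.mpr hd
            obtain ⟨w, hw⟩ := exists_intCast_eq_toZMod hd' (fun hd2 => by
              rw [sq] at hd2
              exact (Nat.prime_iff_prime_int.mp hp).not_isUnit (hsq _ hd2)) (h.2 p hp2)
            obtain ⟨w, rfl⟩ := ZMod.intCast_surjective w
            refine ⟨w, ?_⟩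
            rw [← ZMod.intCast_zmod_eq_zero_iff_dvd]
            push_cast
            rw [hw, sub_self])
      obtain ⟨s, hs, hsl⟩ : ∃ s : ℤ, b ∣ s ^ 2 - a ∧ 2 * |s| ≤ |b| := by
        refine ⟨t.bmod b.natAbs, ?_, ?_⟩
        · rw [Int.natAbs_dvd] at ht
          have h1 : b ∣ t.bmod b.natAbs - t := by
            rw [← Int.natAbs_dvd]
            exact Int.dvd_bmod_sub_self
          have h2 := dvd_add (h1.mul_right (t.bmod b.natAbs + t)) ht
          rwa [show (t.bmod b.natAbs - t) * (t.bmod b.natAbs + t) + (t ^ 2 - a) =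
            t.bmod b.natAbs ^ 2 - a by ring] at h2
        · have h1 := Int.bmod_lt (x := t) (m := b.natAbs) (by omega)
          have h2 := Int.le_bmod (x := t) (m := b.natAbs) (by omega)
          rw [← Int.natCast_natAbs b]
          generalize t.bmod b.natAbs = s at *
          rcases abs_cases s with ⟨h3, -⟩ | ⟨h3, -⟩ <;> rw [h3] <;> omega
      obtain ⟨b', hb'⟩ := hs
      by_cases hb0 : b' = 0
      · subst hb0
        refine conicSolvable_of_sq_left (t := (s : ℚ)) ?_
        have : a = s ^ 2 := by linarith
        rw [this]; push_cast; ring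
      · have hlt : b'.natAbs < b.natAbs := by
          zify
          have e1 : |b| * |b'| ≤ |s| ^ 2 + |b| := by
            rw [← abs_mul, ← hb', ← abs_pow]
            refine (abs_sub _ _).trans ?_
            have : |a| ≤ |b| := by zify at hab; exact hab
            linarith
          have e2 : (2 : ℤ) ≤ |b| := by zify at hb2; exact hb2
          have e3 := abs_nonneg s
          by_contra hcon
          have e4 : |b| * |b| ≤ |b| * |b'| := mul_le_mul_of_nonneg_left (not_lt.mp hcon) (by linarith)
          nlinarith
        have htr : ∀ {K : Type} [Field K] [CharZero K], ∀ x y : ℤ, x ≠ 0 → s ^ 2 - a = x * y →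
            ConicSolvable (a : K) (x : K) → ConicSolvable (a : K) (y : K) := by
          intro K _ _ x y hx hxy hK
          have hc : ((x * y : ℤ) : K) = (s : K) ^ 2 - a * 1 ^ 2 := by
            rw [← hxy]; push_cast; ring
          have := hK.mul_norm hc
          rwa [show (x : K) * ((x * y : ℤ) : K) = y * (x : K) ^ 2 by push_cast; ring,
            conicSolvable_mul_sq_iff (by exact_mod_cast hx)] at this
        exact htr b' b hb0 (by rw [hb', mul_comm])
          (ih _ (by omega) ha hb0 (h.transfer (htr b b' hb hb')) rfl)
    · obtain ⟨c, ⟨b', hb'⟩, hc⟩ : ∃ c, c * c ∣ b ∧ ¬IsUnit c := by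
        simpa [Squarefree] using hsq
      have hc0 : c ≠ 0 := by rintro rfl; simp at hb'; exact hb hb'
      have hb0 : b' ≠ 0 := by rintro rfl; simp at hb'; exact hb hb'
      have htr : ∀ {K : Type} [Field K] [CharZero K],
          ConicSolvable (a : K) (b : K) ↔ ConicSolvable (a : K) (b' : K) := by
        intro K _ _
        rw [hb', show ((c * c * b' : ℤ) : K) = b' * (c : K) ^ 2 by push_cast; ring,
          conicSolvable_mul_sq_iff (by exact_mod_cast hc0)]
      have hlt : b'.natAbs < b.natAbs := by
        rw [hb', Int.natAbs_mul]
        have h1 : 2 ≤ c.natAbs := by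
          rw [Int.isUnit_iff_natAbs_eq] at hc
          omega
        have h2 : 1 ≤ b'.natAbs := by omega
        have h3 : 2 * 2 ≤ (c * c).natAbs := by
          rw [Int.natAbs_mul]
          exact Nat.mul_le_mul h1 h1
        nlinarith
      exact htr.mpr (ih _ (by omega) ha hb0 (h.transfer htr.mp) rfl)

theorem primeSymbol_congr_right {p : ℕ} {β β' : ℤ} (α : ℤ)
    (h : padicValInt p β = padicValInt p β')
    (hu : unitPart p β ≡ unitPart p β' [ZMOD p ^ 3]) :
    primeSymbol p α β = primeSymbol p α β' := by
  unfold primeSymbol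
  split_ifs with hp2
  · subst hp2
    have h8 : ((unitPart 2 β : ℤ) : ZMod 8) = (unitPart 2 β' : ℤ) := by
      rw [ZMod.intCast_eq_intCast_iff]; exact hu
    have h4 : ((unitPart 2 β : ℤ) : ZMod 4) = (unitPart 2 β' : ℤ) := by
      rw [ZMod.intCast_eq_intCast_iff]; exact hu.of_mul_right 2
    rw [h, h8, h4]
  · rw [h, jacobiSym.mod_left' (b := p) (a₁ := unitPart p β) (a₂ := unitPart p β')]
    exact hu.of_dvd (dvd_pow_self _ (by norm_num))

theorem realSymbol_congr_right {β β' : ℤ} (α : ℤ) (h : β.sign = β'.sign) :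
    realSymbol α β = realSymbol α β' := by
  rw [realSymbol, h, realSymbol]

theorem primeSymbol_one_right {p : ℕ} (hp : p.Prime) (α : ℤ) : primeSymbol p α 1 = 1 := by
  obtain ⟨h1, h2⟩ := padicValInt_unitPart_of_not_dvd hp (Nat.prime_iff_prime_int.mp hp).not_dvd_one
  have h4 : ZMod.χ₄ ((1 : ℤ) : ZMod 4) = 1 := by decide
  have h8 : ZMod.χ₈ ((1 : ℤ) : ZMod 8) = 1 := by decide
  unfold primeSymbol
  split_ifs with hp2
  · subst hp2
    rw [h1, h2, h4, h8, signSymbol_comm, signSymbol_one_left]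
    simp
  · rw [h1, h2, jacobiSym.one_left]
    simp

theorem realSymbol_one_right (α : ℤ) : realSymbol α 1 = 1 := by
  simp [realSymbol, signSymbol]

theorem primeSymbol_discr_eq_one {a b c : ℤ} (ha : a ≠ 0) {p : ℕ} (hp : p.Prime)
    (h : ¬(p : ℤ) ∣ 2 * (b ^ 2 - 4 * a * c)) : primeSymbol p a (b ^ 2 - 4 * a * c) = 1 := by
  have := Fact.mk hp
  have hq : ¬(p : ℤ) ∣ b ^ 2 - 4 * a * c := fun hd => h (hd.mul_left _)
  have hp2 : p ≠ 2 := by rintro rfl; exact h (by simp)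
  by_cases hpa : (p : ℤ) ∣ a
  · have hz : ((b ^ 2 - 4 * a * c : ℤ) : ZMod p) = (b : ZMod p) ^ 2 := by
      have : (a : ZMod p) = 0 := (ZMod.intCast_zmod_eq_zero_iff_dvd _ _).mpr hpa
      push_cast
      rw [this]; ring
    have hb : (b : ZMod p) ≠ 0 := by
      intro hb
      apply hq
      rw [← ZMod.intCast_zmod_eq_zero_iff_dvd, hz, hb, zero_pow two_ne_zero]
    have h1 := primeSymbol_pow_mul_unit hp hp2 (padicValInt p a) (not_dvd_unitPart hp ha) hq
    rwa [← eq_pow_mul_unitPart, jacobiSym_eq_one_of_sq hb hz, one_pow] at h1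
  · exact primeSymbol_of_not_dvd hp hp2 hpa hq

/-- Signs that are not a member of a group of sign vectors are separated from it by the product
over some subset of coordinates. -/
theorem exists_finset_prod_eq_neg_one {ι : Type*} [Fintype ι] (T : Set (ι → ℤ))
    (hT : ∀ t ∈ T, ∀ i, t i = 1 ∨ t i = -1) (h1 : (fun _ => 1) ∈ T)
    (hmul : ∀ s ∈ T, ∀ t ∈ T, s * t ∈ T) (e : ι → ℤ) (he : ∀ i, e i = 1 ∨ e i = -1)
    (heT : e ∉ T) :
    ∃ S : Finset ι, (∀ t ∈ T, ∏ i ∈ S, t i = 1) ∧ ∏ i ∈ S, e i = -1 := by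
  let sg : ZMod 2 → ℤ := fun x => if x = 0 then 1 else -1
  have sg_add : ∀ x y, sg (x + y) = sg x * sg y := by decide
  let lg : ℤ → ZMod 2 := fun x => if x = 1 then 0 else 1
  have sg_lg : ∀ x, x = 1 ∨ x = -1 → sg (lg x) = x := by
    rintro x (rfl | rfl) <;> decide
  have sg_sum : ∀ (S : Finset ι) (w : ι → ZMod 2), ∏ i ∈ S, sg (w i) = sg (∑ i ∈ S, w i) := by
    intro S w
    induction S using Finset.induction_on with
    | empty => simp [sg]
    | insert i S hi ih => rw [Finset.prod_insert hi, Finset.sum_insert hi, sg_add, ih]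
  let W : Submodule (ZMod 2) (ι → ZMod 2) :=
    { carrier := {w | (fun i => sg (w i)) ∈ T}
      zero_mem' := by simpa [sg] using h1
      add_mem' := by
        intro v w hv hw
        have := hmul _ hv _ hw
        simp only [Set.mem_ofPred_eq, Pi.add_apply, sg_add]
        exact this
      smul_mem' := by
        intro k w hw
        have hk : k = 0 ∨ k = 1 := by revert k; decide
        rcases hk with rfl | rfl
        · simpa [sg] using h1
        · simpa using hw }
  have heW : (fun i => lg (e i)) ∉ W := by
    intro h
    apply heT
    have h : (fun i => sg (lg (e i))) ∈ T := h
    rwa [funext fun i => sg_lg _ (he i)] at h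
  obtain ⟨f, hf, hfW⟩ := Submodule.exists_le_ker_of_notMem heW
  have hfS : ∀ w, f w = ∑ i ∈ Finset.univ.filter (fun i => f (Pi.single i 1) ≠ 0), w i := by
    intro w
    conv_lhs => rw [← Finset.univ_sum_single w, map_sum]
    rw [Finset.sum_filter]
    refine Finset.sum_congr rfl fun i _ => ?_
    have h2 : ∀ x : ZMod 2, x ≠ 0 → x = 1 := by decide
    rw [show Pi.single i (w i) = w i • (Pi.single i 1 : ι → ZMod 2) by
      rw [← Pi.single_smul, smul_eq_mul, mul_one], map_smul, smul_eq_mul]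
    split_ifs with h
    · rw [h2 _ h, mul_one]
    · rw [not_not.mp h, mul_zero]
  refine ⟨Finset.univ.filter (fun i => f (Pi.single i 1) ≠ 0), fun t ht => ?_, ?_⟩
  · rw [← Finset.prod_congr rfl fun i _ => sg_lg _ (hT t ht i), sg_sum, ← hfS]
    have : (fun i => lg (t i)) ∈ W := by
      change (fun i => sg (lg (t i))) ∈ T
      rwa [funext fun i => sg_lg _ (hT t ht i)]
    exact if_pos (hfW this)
  · rw [← Finset.prod_congr rfl fun i _ => sg_lg _ (he i), sg_sum, ← hfS]
    exact if_neg hf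

/-- Simultaneous weak approximation at the primes of `P` by a prime outside of `P`. -/
theorem exists_prime_modEq_pow_three {P : Finset ℕ} (hP : ∀ p ∈ P, p.Prime) (a : ℕ → ℤ)
    (ha : ∀ p ∈ P, ¬(p : ℤ) ∣ a p) :
    ∃ l : ℕ, l.Prime ∧ l ∉ P ∧ ∀ p ∈ P, (l : ℤ) ≡ a p [ZMOD p ^ 3] := by
  have h0 : ∀ p ∈ P, p ^ 3 ≠ 0 := fun p hp => pow_ne_zero _ (hP p hp).ne_zero
  obtain ⟨k, hk⟩ := Nat.chineseRemainderOfFinset (fun p => (a p % (p : ℤ) ^ 3).toNat)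
    (fun p => p ^ 3) P h0 (fun p hp r hr hpr =>
      Nat.Coprime.pow 3 3 ((Nat.coprime_primes (hP p hp) (hP r hr)).mpr hpr))
  have hka : ∀ p ∈ P, (k : ℤ) ≡ a p [ZMOD p ^ 3] := by
    intro p hp
    have h1 := Int.natCast_modEq_iff.mpr (hk p hp)
    rw [Int.toNat_of_nonneg (Int.emod_nonneg _ (by exact_mod_cast h0 p hp))] at h1
    push_cast at h1
    exact h1.trans (Int.mod_modEq _ _)
  have hcop : Nat.Coprime k (∏ p ∈ P, p ^ 3) := by
    refine Nat.Coprime.prod_right fun p hp => Nat.Coprime.pow_right 3 ?_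
    rw [Nat.coprime_comm, (hP p hp).coprime_iff_not_dvd]
    intro hd
    have h1 : (k : ℤ) ≡ a p [ZMOD p] := (hka p hp).of_dvd (dvd_pow_self _ (by norm_num))
    exact ha p hp (h1.dvd_iff.mp (by exact_mod_cast hd))
  obtain ⟨l, hl, hlp, hlk⟩ := Nat.forall_exists_prime_gt_and_zmodEq (P.sup id)
    (Finset.prod_ne_zero_iff.mpr h0) (Nat.isCoprime_iff_coprime.mpr hcop)
  refine ⟨l, hlp, fun hmem => ?_, fun p hp => ?_⟩
  · exact absurd (Finset.le_sup (f := id) hmem) (not_le.mpr hl)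
  · refine Int.ModEq.trans (hlk.of_dvd ?_) (hka p hp)
    exact_mod_cast Finset.dvd_prod_of_mem (fun p => p ^ 3) hp

/-- An inverse modulo a power of `p`. -/
theorem exists_mul_modEq {p : ℕ} (hp : p.Prime) {u : ℤ} (hu : ¬(p : ℤ) ∣ u) (w : ℤ) (n : ℕ) :
    ∃ r : ℤ, u * r ≡ w [ZMOD p ^ n] := by
  obtain ⟨x, y, hxy⟩ := (((Nat.prime_iff_prime_int.mp hp).coprime_iff_not_dvd.mpr hu).symm).pow_right
    (n := n)
  refine ⟨x * w, ?_⟩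
  rw [Int.modEq_iff_dvd]
  exact ⟨y * w, by linear_combination w * (-hxy)⟩

/-- A prime `l` modulo which `-1`, `2` and all the primes in `P` are squares is itself a square at
the primes of `P`. -/
theorem sq_of_jacobiSym_eq_one {P : Finset ℕ} (h2 : 2 ∈ P) (hP : ∀ p ∈ P, p.Prime) {l : ℕ}
    (hl : l.Prime) (hlP : l ∉ P)
    (h : ∀ s : ℤ, s ≠ 0 → (∀ p : ℕ, p.Prime → (p : ℤ) ∣ s → p ∈ P) → J(s | l) = 1) :
    l % 8 = 1 ∧ ∀ p ∈ P, p ≠ 2 → J(l | p) = 1 := by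
  have hl2 : l ≠ 2 := by rintro rfl; exact hlP h2
  have ho := hl.odd_of_ne_two hl2
  have hprime : ∀ p ∈ P, J(p | l) = 1 := by
    intro p hp
    refine h p (by exact_mod_cast (hP p hp).ne_zero) fun r hr hd => ?_
    rw [(Nat.prime_dvd_prime_iff_eq hr (hP p hp)).mp (by exact_mod_cast hd)]
    exact hp
  have h4 : J(-1 | l) = 1 := h (-1) (by norm_num) fun r hr hd => absurd hd (not_dvd_neg_one hr)
  have h8 := hprime 2 h2
  rw [Nat.cast_two, jacobiSym.at_two ho, ZMod.χ₈_nat_eq_if_mod_eight] at h8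
  rw [jacobiSym.at_neg_one ho, ZMod.χ₄_nat_eq_if_mod_four] at h4
  have h8' : l % 8 = 1 := by
    split_ifs at h4 h8 <;> omega
  refine ⟨h8', fun p hp hp2 => ?_⟩
  rw [jacobiSym.quadratic_reciprocity_one_mod_four (by omega) ((hP p hp).odd_of_ne_two hp2)]
  exact hprime p hp

theorem padicValInt_prod_prime_pow {p : ℕ} (hp : p.Prime) {S : Finset ℕ}
    (hS : ∀ r ∈ S, r.Prime) (e : ℕ → ℕ) :
    padicValInt p (∏ r ∈ S, (r : ℤ) ^ e r) = if p ∈ S then e p else 0 := by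
  have := Fact.mk hp
  induction S using Finset.induction_on with
  | empty => simp
  | insert r S hr ih =>
    have hS' : ∀ r ∈ S, r.Prime := fun r h => hS r (Finset.mem_insert_of_mem h)
    have h0 : ∀ r : ℕ, r.Prime → (r : ℤ) ^ e r ≠ 0 := fun r h =>
      pow_ne_zero _ (by exact_mod_cast h.ne_zero)
    have hrp := hS r (Finset.mem_insert_self _ _)
    rw [Finset.prod_insert hr, padicValInt.mul (h0 r hrp)
      (Finset.prod_ne_zero_iff.mpr fun r h => h0 r (hS' r h)), ih hS']
    by_cases hpr : p = r
    · subst hpr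
      have h1 := padicValInt_pow_mul hp (e p) (u := 1) (Nat.prime_iff_prime_int.mp hp).not_dvd_one
      rw [mul_one] at h1
      rw [h1, if_neg hr, if_pos (Finset.mem_insert_self _ _), add_zero]
    · have h1 : padicValInt p ((r : ℤ) ^ e r) = 0 := by
        refine padicValInt.eq_zero_of_not_dvd fun hd => hpr ?_
        have hd' := (Nat.prime_iff_prime_int.mp hp).dvd_of_dvd_pow hd
        exact (Nat.prime_dvd_prime_iff_eq hp hrp).mp (by exact_mod_cast hd')
      simp [h1, hpr]

/-- The divisor of `q` with a prescribed sign which has the valuation of `q` at the primes of `S`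
and no other prime factors. -/
theorem exists_dvd_padicValInt_eq {S : Finset ℕ} (hS : ∀ p ∈ S, p.Prime) (q : ℤ)
    {σ : ℤ} (hσ : σ = 1 ∨ σ = -1) :
    ∃ d : ℤ, d ≠ 0 ∧ d ∣ q ∧ d.sign = σ ∧ (∀ p : ℕ, p.Prime → (p : ℤ) ∣ d → p ∈ S) ∧
      ∀ p : ℕ, p.Prime → padicValInt p d = if p ∈ S then padicValInt p q else 0 := by
  have hpos : 0 < ∏ p ∈ S, (p : ℤ) ^ padicValInt p q :=
    Finset.prod_pos fun p hp => pow_pos (by exact_mod_cast (hS p hp).pos) _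
  have hσ0 : σ ≠ 0 := by rcases hσ with rfl | rfl <;> norm_num
  have hσu : IsUnit σ := Int.isUnit_iff.mpr hσ
  refine ⟨σ * ∏ p ∈ S, (p : ℤ) ^ padicValInt p q, mul_ne_zero hσ0 hpos.ne', ?_, ?_, ?_, ?_⟩
  · rw [hσu.mul_left_dvd]
    refine Finset.prod_dvd_of_coprime (fun p hp r hr hpr => ?_) fun p hp => padicValInt_dvd q
    exact IsCoprime.pow (Nat.isCoprime_iff_coprime.mpr
      ((Nat.coprime_primes (hS p hp) (hS r hr)).mpr hpr))
  · rw [Int.sign_mul, Int.sign_eq_one_of_pos hpos, mul_one]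
    rcases hσ with rfl | rfl <;> rfl
  · intro p hp hd
    have hp' := Nat.prime_iff_prime_int.mp hp
    rw [hσu.dvd_mul_left, hp'.dvd_finsetProd_iff] at hd
    obtain ⟨r, hr, hd⟩ := hd
    have hd := hp'.dvd_of_dvd_pow hd
    rw [(Nat.prime_dvd_prime_iff_eq hp (hS r hr)).mp (by exact_mod_cast hd)]
    exact hr
  · intro p hp
    have := Fact.mk hp
    rw [padicValInt.mul hσ0 hpos.ne', padicValInt_prod_prime_pow hp hS]
    have : padicValInt p σ = 0 := by rcases hσ with rfl | rfl <;> simp [padicValInt]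
    rw [this, zero_add]

/-- If the unit parts of `d` and `w` differ by a prime `l` which is a square at `p`, then `d * w`
is a square at `p` as soon as the valuations agree. -/
theorem padic_sq_of_unitPart {p : ℕ} [hp : Fact p.Prime] {d w l : ℤ} (hd : d ≠ 0)
    (hval : padicValInt p d = padicValInt p w)
    (hl : unitPart p d * l ≡ unitPart p w [ZMOD p ^ 3]) (hl2 : p = 2 → l % 8 = 1)
    (hlp : p ≠ 2 → J(l | p) = 1) : ∃ x : ℚ_[p], ((d * w : ℤ) : ℚ_[p]) = x ^ 2 := by
  have hu := not_dvd_unitPart hp.out hd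
  have huw : unitPart p d * unitPart p w ≡ unitPart p d * unitPart p d * l [ZMOD p ^ 3] := by
    rw [mul_assoc]
    exact (hl.mul_left _).symm
  obtain ⟨x, hx⟩ : ∃ x : ℤ_[p], ((unitPart p d * unitPart p w : ℤ) : ℤ_[p]) = x ^ 2 := by
    by_cases hp2 : p = 2
    · subst hp2
      refine padicInt_two_sq ?_
      have h8 : unitPart 2 d * unitPart 2 w ≡ unitPart 2 d * unitPart 2 d * l [ZMOD 8] := huw
      have hsq : unitPart 2 d * unitPart 2 d % 8 = 1 := by
        have : unitPart 2 d % 8 = 1 ∨ unitPart 2 d % 8 = 3 ∨ unitPart 2 d % 8 = 5 ∨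
            unitPart 2 d % 8 = 7 := by omega
        rcases this with h | h | h | h <;> simp [Int.mul_emod, h]
      rw [h8.eq, Int.mul_emod, hsq, hl2 rfl]
      rfl
    · refine padicInt_sq_of_jacobiSym hp2 ?_
      rw [jacobiSym.mod_left' (huw.of_dvd (dvd_pow_self _ (by norm_num))), jacobiSym.mul_left,
        jacobiSym.mul_left, hlp hp2, mul_one]
      rcases jacobiSym_eq_or hp.out hu with h | h <;> rw [h] <;> rfl
  refine ⟨(p : ℚ_[p]) ^ padicValInt p d * x, ?_⟩
  have hx := congrArg (fun x : ℤ_[p] => (x : ℚ_[p])) hx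
  push_cast at hx
  rw [mul_pow, ← hx]
  conv_lhs => rw [eq_pow_mul_unitPart p d, eq_pow_mul_unitPart p w, ← hval]
  push_cast
  ring

/-- If the product of the symbols with `q` over a set of places is trivial on `P`-units, then
this set is cut out by a divisor `d` of `q`: up to squares `d` is `q` at the places of the set and
`1` at the others. -/
theorem exists_dvd_local_sq {P : Finset ℕ} (hP : ∀ p ∈ P, p.Prime) (h2 : 2 ∈ P) {q : ℤ}
    (hq : q ≠ 0) (R : Prop) {S : Finset ℕ} (hSP : S ⊆ P)
    (H : ∀ t : ℤ, t ≠ 0 → (∀ p : ℕ, p.Prime → (p : ℤ) ∣ t → p ∈ P) →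
      (if R then realSymbol t q else 1) * ∏ p ∈ S, primeSymbol p t q = 1) :
    ∃ d : ℤ, d ≠ 0 ∧ d ∣ q ∧ d.sign = (if R then q else 1).sign ∧
      ∀ p ∈ P, ∀ [Fact p.Prime], ∃ x : ℚ_[p],
        ((d * if p ∈ S then q else 1 : ℤ) : ℚ_[p]) = x ^ 2 := by
  have hw0 : ∀ (B : Prop) [Decidable B], (if B then q else 1) ≠ 0 := by intro B _; split_ifs <;> simp [hq]
  obtain ⟨d, hd0, hdq, hsign, hdS, hval⟩ := exists_dvd_padicValInt_eq
    (fun p hp => hP p (hSP hp)) q (sign_eq_or (hw0 R))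
  have hval' : ∀ p, p.Prime → padicValInt p d = padicValInt p (if p ∈ S then q else 1) := by
    intro p hp
    rw [hval p hp]
    split_ifs <;> simp
  choose! r hr using fun p (hp : p ∈ P) =>
    exists_mul_modEq (hP p hp) (not_dvd_unitPart (hP p hp) hd0)
      (unitPart p (if p ∈ S then q else 1)) 3
  obtain ⟨l, hl, hlP, hlr⟩ := exists_prime_modEq_pow_three hP r (by
    intro p hp hd
    have h1 := (hr p hp).of_dvd (dvd_pow_self (p : ℤ) three_ne_zero)
    exact not_dvd_unitPart (hP p hp) (hw0 (p ∈ S)) (h1.dvd_iff.mp (hd.mul_left _)))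
  have hl' := Nat.prime_iff_prime_int.mp hl
  have hl0 : (l : ℤ) ≠ 0 := hl'.ne_zero
  have hlr' : ∀ p ∈ P, unitPart p d * l ≡ unitPart p (if p ∈ S then q else 1) [ZMOD p ^ 3] :=
    fun p hp => ((hlr p hp).mul_left _).trans (hr p hp)
  have hpl : ∀ p ∈ P, ¬(p : ℤ) ∣ l := by
    intro p hp hd
    rw [(Nat.prime_dvd_prime_iff_eq (hP p hp) hl).mp (by exact_mod_cast hd)] at hp
    exact hlP hp
  have hsymb : ∀ (p : ℕ) (hp : p ∈ P) (s : ℤ), primeSymbol p s (d * l) =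
      primeSymbol p s (if p ∈ S then q else 1) := by
    intro p hp s
    obtain ⟨h1, h2⟩ := padicValInt_unitPart_mul (hP p hp) hd0 hl0
    obtain ⟨h3, h4⟩ := padicValInt_unitPart_of_not_dvd (hP p hp) (hpl p hp)
    refine primeSymbol_congr_right s ?_ ?_
    · rw [h1, h3, add_zero, hval' p (hP p hp)]
    · rw [h2, h4]
      exact hlr' p hp
  have hjac : ∀ s : ℤ, s ≠ 0 → (∀ p : ℕ, p.Prime → (p : ℤ) ∣ s → p ∈ P) → J(s | l) = 1 := by
    intro s hs hsP
    have hrec := symbolProd_eq_one (P := insert l P) (α := s) (β := d * l)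
      (by simpa [hl] using hP) (Finset.mem_insert_of_mem h2) hs (mul_ne_zero hd0 hl0)
      (fun p hp hd => Finset.mem_insert_of_mem (hsP p hp hd)) (by
        intro p hp hd
        rcases (Nat.prime_iff_prime_int.mp hp).dvd_or_dvd hd with hd | hd
        · exact Finset.mem_insert_of_mem (hSP (hdS p hp hd))
        · rw [(Nat.prime_dvd_prime_iff_eq hp hl).mp (by exact_mod_cast hd)]
          exact Finset.mem_insert_self _ _)
    have hreal : realSymbol s (d * l) = if R then realSymbol s q else 1 := by
      rw [realSymbol_congr_right (β' := if R then q else 1)]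
      · split_ifs
        · rfl
        · exact realSymbol_one_right s
      · rw [Int.sign_mul, hsign,
          Int.sign_eq_one_of_pos (a := (l : ℤ)) (by exact_mod_cast hl.pos), mul_one]
    have hprod : ∏ p ∈ P, primeSymbol p s (d * l) = ∏ p ∈ S, primeSymbol p s q := by
      rw [← Finset.prod_subset_one_on_sdiff hSP (fun p hp => ?_) fun p hp => ?_]
      · obtain ⟨hp1, hp2⟩ := Finset.mem_sdiff.mp hp
        rw [hsymb p hp1, if_neg hp2, primeSymbol_one_right (hP p hp1)]
      · rw [hsymb p (hSP hp), if_pos hp]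
    have hls : ¬(l : ℤ) ∣ s := fun hd => hlP (hsP l hl hd)
    have hld : ¬(l : ℤ) ∣ d := fun hd => hlP (hSP (hdS l hl hd))
    rw [symbolProd, Finset.prod_insert hlP, hreal, hprod, mul_left_comm, H s hs hsP, mul_one,
      primeSymbol_comm, mul_comm] at hrec
    have h1 := primeSymbol_pow_mul_unit hl (fun h => hlP (h ▸ h2)) 1 hld hls
    rwa [pow_one, pow_one, hrec, eq_comm] at h1
  obtain ⟨hl8, hlj⟩ := sq_of_jacobiSym_eq_one h2 hP hl hlP hjac
  refine ⟨d, hd0, hdq, hsign, fun p hp _ => ?_⟩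
  exact padic_sq_of_unitPart hd0 (hval' p (hP p hp)) (hlr' p hp)
    (fun _ => by exact_mod_cast hl8) (hlj p hp)

theorem eq_of_eq_one_iff {x y : ℤ} (hx : x = 1 ∨ x = -1) (hy : y = 1 ∨ y = -1)
    (h : x = 1 ↔ y = 1) : x = y := by
  rcases hx with rfl | rfl <;> rcases hy with rfl | rfl <;> simp_all

theorem eq_of_mul_eq_one {x y : ℤ} (hx : x = 1 ∨ x = -1) (hy : y = 1 ∨ y = -1)
    (h : x * y = 1) : y = x := by
  rcases hx with rfl | rfl <;> rcases hy with rfl | rfl <;> simp_all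

theorem realSymbol_eq_or (α β : ℤ) : realSymbol α β = 1 ∨ realSymbol α β = -1 :=
  signSymbol_eq_or _ _

theorem isSquareR_iff {d : ℚ} : IsSquareR d ↔ 0 ≤ d := by
  rw [IsSquareR]
  refine ⟨fun ⟨t, ht⟩ => ?_, fun h => ⟨√(d : ℝ), ?_⟩⟩
  · have : (0 : ℝ) ≤ d := ht ▸ sq_nonneg t
    exact_mod_cast this
  · rw [Real.sq_sqrt (by exact_mod_cast h)]

theorem hilbertQp_neg_mul_eq_primeSymbol {p : ℕ} (hp : p.Prime) {a q : ℤ} (ha : a ≠ 0)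
    (hq : q ≠ 0) : hilbertQp p (a : ℚ) (-(a : ℚ) * (q : ℚ)) = primeSymbol p a q := by
  have := Fact.mk hp
  refine eq_of_eq_one_iff (hilbertQp_eq_or _ _ _) (primeSymbol_eq_or hp ha hq) ?_
  rw [hilbertQp_eq_one_iff, primeSymbol_eq_one_iff ha hq,
    ← conicSolvable_neg_mul_iff (α := (a : ℚ_[p])) (by exact_mod_cast ha)]
  push_cast
  rfl

theorem hilbertR_neg_mul_eq_realSymbol {a q : ℤ} (ha : a ≠ 0) :
    hilbertR (a : ℚ) (-(a : ℚ) * (q : ℚ)) = realSymbol a q := by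
  refine eq_of_eq_one_iff (hilbertR_eq_or _ _) (realSymbol_eq_or _ _) ?_
  rw [hilbertR_eq_one_iff, realSymbol_eq_one_iff ha,
    ← conicSolvable_neg_mul_iff (α := (a : ℝ)) (by exact_mod_cast ha)]
  push_cast
  rfl

theorem primeSymbol_eq_one_of_sq {p : ℕ} [Fact p.Prime] {α β : ℤ} (hα : α ≠ 0) (hβ : β ≠ 0)
    (h : IsSquareQp p (β : ℚ)) : primeSymbol p α β = 1 := by
  obtain ⟨t, ht⟩ := isSquareQp_iff.mp h
  rw [primeSymbol_eq_one_iff hα hβ]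
  exact conicSolvable_of_sq_right (t := t) (by exact_mod_cast ht)

theorem realSymbol_eq_one_of_sq {α β : ℤ} (h : IsSquareR (β : ℚ)) : realSymbol α β = 1 := by
  have h : 0 ≤ β := by exact_mod_cast isSquareR_iff.mp h
  rw [realSymbol, signSymbol, if_neg]
  rintro ⟨-, h1⟩
  rw [Int.sign_eq_neg_one_iff_neg] at h1
  omega

theorem primeSymbol_eq_of_div_sq {p : ℕ} [hp : Fact p.Prime] {α β γ : ℤ} (hα : α ≠ 0)
    (hβ : β ≠ 0) (hγ : γ ≠ 0) (h : IsSquareQp p ((β : ℚ) / γ)) :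
    primeSymbol p α β = primeSymbol p α γ := by
  obtain ⟨t, ht⟩ := isSquareQp_iff.mp h
  refine eq_of_eq_one_iff (primeSymbol_eq_or hp.out hα hβ) (primeSymbol_eq_or hp.out hα hγ) ?_
  have hγ' : (γ : ℚ_[p]) ≠ 0 := by exact_mod_cast hγ
  have hβ' : (β : ℚ_[p]) ≠ 0 := by exact_mod_cast hβ
  push_cast at ht
  have hβt : (β : ℚ_[p]) = γ * t ^ 2 := by rw [← ht]; field_simp
  have ht0 : t ≠ 0 := by rintro rfl; simp [hβ] at hβt
  rw [primeSymbol_eq_one_iff hα hβ, primeSymbol_eq_one_iff hα hγ, hβt, conicSolvable_mul_sq_iff ht0]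

theorem realSymbol_eq_of_div_sq {α β γ : ℤ} (hβ : β ≠ 0) (hγ : γ ≠ 0)
    (h : IsSquareR ((β : ℚ) / γ)) : realSymbol α β = realSymbol α γ := by
  have h := isSquareR_iff.mp h
  refine realSymbol_congr_right α ?_
  rcases lt_or_gt_of_ne hβ with hb | hb <;> rcases lt_or_gt_of_ne hγ with hc | hc
  · rw [Int.sign_eq_neg_one_of_neg hb, Int.sign_eq_neg_one_of_neg hc]
  · exact absurd h (not_le.mpr (div_neg_of_neg_of_pos (by exact_mod_cast hb) (by exact_mod_cast hc)))
  · exact absurd h (not_le.mpr (div_neg_of_pos_of_neg (by exact_mod_cast hb) (by exact_mod_cast hc)))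
  · rw [Int.sign_eq_one_of_pos hb, Int.sign_eq_one_of_pos hc]

/-- Reciprocity for the symbol of `a` and the discriminant, which is trivial away from the primes
dividing twice the discriminant. -/
theorem symbolProd_discr_eq_one {a b c q : ℤ} (hq : q = b ^ 2 - 4 * a * c) (ha : a ≠ 0)
    (hq0 : q ≠ 0) {P : Finset ℕ} (hP : ∀ p : ℕ, p ∈ P ↔ p.Prime ∧ (p : ℤ) ∣ 2 * q) :
    symbolProd P a q = 1 := by
  have h2 : 2 ∈ P := (hP 2).mpr ⟨Nat.prime_two, by simp⟩
  have hprime : ∀ p ∈ P ∪ a.natAbs.primeFactors, p.Prime := by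
    intro p hp
    rcases Finset.mem_union.mp hp with hp | hp
    · exact ((hP p).mp hp).1
    · exact Nat.prime_of_mem_primeFactors hp
  rw [← symbolProd_eq_prod_subset (P' := P ∪ a.natAbs.primeFactors) Finset.subset_union_left]
  · refine symbolProd_eq_one hprime (Finset.mem_union_left _ h2) ha hq0 ?_ ?_
    · intro p hp hd
      exact Finset.mem_union_right _ (Nat.mem_primeFactors.mpr
        ⟨hp, Int.natCast_dvd.mp hd, by simpa using ha⟩)
    · intro p hp hd
      exact Finset.mem_union_left _ ((hP p).mpr ⟨hp, hd.mul_left _⟩)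
  · intro p hp hpP
    have hpp := hprime p hp
    subst hq
    exact primeSymbol_discr_eq_one ha hpp fun hd => hpP ((hP p).mpr ⟨hpp, hd⟩)

/-- An integer whose symbols with the discriminant agree with those of `a` is a value of the
form. -/
theorem exists_value_of_symbol_eq {a b c q : ℤ} (hq : q = b ^ 2 - 4 * a * c) (ha : a ≠ 0)
    (hq0 : q ≠ 0) (hqns : ¬∃ s : ℚ, s ^ 2 = (q : ℚ)) {P : Finset ℕ}
    (hP : ∀ p : ℕ, p ∈ P ↔ p.Prime ∧ (p : ℤ) ∣ 2 * q) {t : ℤ} (ht : t ≠ 0)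
    (htP : ∀ p : ℕ, p.Prime → (p : ℤ) ∣ t → p ∈ P) (hR : realSymbol t q = realSymbol a q)
    (hpt : ∀ p ∈ P, primeSymbol p t q = primeSymbol p a q) :
    ∃ x y : ℚ, (a : ℚ) * x ^ 2 + (b : ℚ) * x * y + (c : ℚ) * y ^ 2 = t := by
  have hat : a * t ≠ 0 := mul_ne_zero ha ht
  have hsq : ∀ {x : ℤ}, x = 1 ∨ x = -1 → x * x = 1 := by rintro x (rfl | rfl) <;> rfl
  have hloc : LocallySolvable (a * t) q := by
    constructor
    · rw [← realSymbol_eq_one_iff hat, realSymbol_mul_left ha ht, hR, hsq (realSymbol_eq_or _ _)]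
    · intro p hp hp2
      rw [← primeSymbol_eq_one_iff hat hq0, primeSymbol_mul_left hp.out ha ht]
      by_cases hpP : p ∈ P
      · rw [hpt p hpP, hsq (primeSymbol_eq_or hp.out ha hq0)]
      · have hd : ¬(p : ℤ) ∣ 2 * q := fun hd => hpP ((hP p).mpr ⟨hp.out, hd⟩)
        rw [primeSymbol_of_not_dvd hp.out hp2 (fun hd => hpP (htP p hp.out hd))
          (fun h => hd (h.mul_left _)), mul_one]
        subst hq
        exact primeSymbol_discr_eq_one ha hp.out hd
  rcases (hloc.conicSolvable hat hq0).symm.exists_norm with ⟨s, hs⟩ | ⟨z, y, hzy⟩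
  · exact absurd ⟨s, hs.symm⟩ hqns
  · have ha' : (a : ℚ) ≠ 0 := by exact_mod_cast ha
    refine ⟨(z - b * y) / a, 2 * y, ?_⟩
    have e : (a : ℚ) * t = z ^ 2 - ((b : ℚ) ^ 2 - 4 * a * c) * y ^ 2 := by
      rw [hq] at hzy; push_cast at hzy; exact hzy
    field_simp
    linear_combination -e

/-- A value of the form of even valuation away from `P` excludes an obstruction. -/
theorem prod_eq_one_of_value {a b c q : ℤ} (hq : q = b ^ 2 - 4 * a * c) (ha : a ≠ 0)
    (hq0 : q ≠ 0) {P : Finset ℕ}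
    (hP : ∀ p : ℕ, p ∈ P ↔ p.Prime ∧ (p : ℤ) ∣ 2 * q) {x y : ℚ}
    (hf : (a : ℚ) * x ^ 2 + (b : ℚ) * x * y + (c : ℚ) * y ^ 2 ≠ 0)
    (heven : ∀ p : ℕ, p.Prime → ¬((p : ℤ) ∣ 2 * q) →
      Even (padicValRat p ((a : ℚ) * x ^ 2 + (b : ℚ) * x * y + (c : ℚ) * y ^ 2)))
    {d : ℤ} (hd0 : d ≠ 0) (hdq : d ∣ 2 * q)
    (hdR : IsSquareR (d : ℚ) ∨ IsSquareR ((d : ℚ) / (q : ℚ)))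
    (hdP : ∀ p ∈ P, IsSquareQp p (d : ℚ) ∨ IsSquareQp p ((d : ℚ) / (q : ℚ))) :
    (if ¬IsSquareR (d : ℚ) then realSymbol a q else 1) *
      (∏ p ∈ P, if ¬IsSquareQp p (d : ℚ) then primeSymbol p a q else 1) = 1 := by
  have h2 : 2 ∈ P := (hP 2).mpr ⟨Nat.prime_two, by simp⟩
  obtain ⟨F, hF⟩ : ∃ F : ℚ, F = (a : ℚ) * x ^ 2 + (b : ℚ) * x * y + (c : ℚ) * y ^ 2 := ⟨_, rfl⟩
  rw [← hF] at hf
  simp only [← hF] at heven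
  have hden : (F.den : ℤ) ≠ 0 := by exact_mod_cast F.den_nz
  have hnum : F.num ≠ 0 := Rat.num_ne_zero.mpr hf
  obtain ⟨N, hN⟩ : ∃ N : ℤ, N = F.num * F.den := ⟨_, rfl⟩
  have hN0 : N ≠ 0 := hN ▸ mul_ne_zero hnum hden
  have hNF : (N : ℚ) = F * (F.den : ℚ) ^ 2 := by
    rw [hN, Int.cast_mul, ← Rat.mul_den_eq_num, Int.cast_natCast]
    ring
  have hNeven : ∀ p : ℕ, p.Prime → ¬((p : ℤ) ∣ 2 * q) → Even (padicValInt p N) := by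
    intro p hp hpq
    have := Fact.mk hp
    have h1 := heven p hp hpq
    have h2 : padicValRat p (N : ℚ) = padicValRat p F + 2 * padicValRat p (F.den : ℚ) := by
      have hden' : (F.den : ℚ) ≠ 0 := by exact_mod_cast hden
      rw [hNF, sq, padicValRat.mul hf (mul_ne_zero hden' hden'), padicValRat.mul hden' hden',
        two_mul]
    rw [padicValRat.of_int] at h2
    have h3 : Even ((padicValInt p N : ℕ) : ℤ) := by
      rw [h2]
      exact h1.add (even_two_mul _)
    exact_mod_cast h3
  have hconic : ConicSolvable ((a * N : ℤ) : ℚ) (q : ℚ) := by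
    refine ConicSolvable.symm (conicSolvable_of_norm
      (z := (a * x + b * y / 2) * F.den) (x := y / 2 * F.den) ?_)
    push_cast
    rw [hNF, hF, hq]
    push_cast
    ring
  have haN : a * N ≠ 0 := mul_ne_zero ha hN0
  have hNR : realSymbol N q = realSymbol a q := by
    refine eq_of_mul_eq_one (realSymbol_eq_or _ _) (realSymbol_eq_or _ _) ?_
    rw [← realSymbol_mul_left ha hN0, realSymbol_eq_one_iff haN]
    have := hconic.map (algebraMap ℚ ℝ)
    simpa using this
  have hNp : ∀ p : ℕ, p.Prime → primeSymbol p N q = primeSymbol p a q := by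
    intro p hp
    have := Fact.mk hp
    refine eq_of_mul_eq_one (primeSymbol_eq_or hp ha hq0) (primeSymbol_eq_or hp hN0 hq0) ?_
    rw [← primeSymbol_mul_left hp ha hN0, primeSymbol_eq_one_iff haN hq0]
    have := hconic.map (algebraMap ℚ ℚ_[p])
    simpa using this
  have hprime : ∀ p ∈ P ∪ N.natAbs.primeFactors, p.Prime := by
    intro p hp
    rcases Finset.mem_union.mp hp with hp | hp
    · exact ((hP p).mp hp).1
    · exact Nat.prime_of_mem_primeFactors hp
  have hrec : symbolProd P N d = 1 := by
    rw [← symbolProd_eq_prod_subset (P' := P ∪ N.natAbs.primeFactors) Finset.subset_union_left]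
    · refine symbolProd_eq_one hprime (Finset.mem_union_left _ h2) hN0 hd0 ?_ ?_
      · intro p hp hd
        exact Finset.mem_union_right _ (Nat.mem_primeFactors.mpr
          ⟨hp, Int.natCast_dvd.mp hd, by simpa using hN0⟩)
      · intro p hp hd
        exact Finset.mem_union_left _ ((hP p).mpr ⟨hp, hd.trans hdq⟩)
    · intro p hp hpP
      have hpp := hprime p hp
      have hpq : ¬(p : ℤ) ∣ 2 * q := fun hd => hpP ((hP p).mpr ⟨hpp, hd⟩)
      exact primeSymbol_of_even hpp (fun h => hpP (h ▸ h2)) (fun hd => hpq (hd.trans hdq))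
        (hNeven p hpp hpq)
  refine Eq.trans ?_ hrec
  rw [symbolProd]
  congr 1
  · by_cases h : IsSquareR (d : ℚ)
    · rw [if_neg (not_not.mpr h), realSymbol_eq_one_of_sq h]
    · rw [if_pos h, ← hNR, realSymbol_eq_of_div_sq hd0 hq0 (hdR.resolve_left h)]
  · refine Finset.prod_congr rfl fun p hp => ?_
    have hpp := ((hP p).mp hp).1
    have := Fact.mk hpp
    by_cases h : IsSquareQp p (d : ℚ)
    · rw [if_neg (not_not.mpr h), primeSymbol_eq_one_of_sq hN0 hd0 h]
    · rw [if_pos h, ← hNp p hpp,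
        primeSymbol_eq_of_div_sq hN0 hd0 hq0 ((hdP p hp).resolve_left h)]

theorem prod_option_elim {P : Finset ℕ} (S : Finset (Option P)) (x : ℤ) (f : ℕ → ℤ) :
    ∏ i ∈ S, i.elim x (fun p => f p) = (if none ∈ S then x else 1) *
      ∏ p ∈ S.eraseNone.map (Function.Embedding.subtype (· ∈ P)), f p := by
  have h : ∏ p ∈ S.eraseNone.map (Function.Embedding.subtype (· ∈ P)), f p =
      ∏ i ∈ S.erase none, i.elim x (fun p => f p) := by
    rw [← Finset.map_some_eraseNone, Finset.prod_map, Finset.prod_map]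
    rfl
  rw [h]
  split_ifs with hS
  · rw [← Finset.mul_prod_erase S _ hS]
    rfl
  · rw [Finset.erase_eq_of_notMem hS, one_mul]

/-- If no integer supported on `P` has the symbols of `a`, then some set of places separates
`a` from all these integers. -/
theorem exists_separating_places {a q : ℤ} (ha : a ≠ 0) (hq0 : q ≠ 0) {P : Finset ℕ}
    (hP : ∀ p ∈ P, p.Prime)
    (H : ∀ t : ℤ, t ≠ 0 → (∀ p : ℕ, p.Prime → (p : ℤ) ∣ t → p ∈ P) →
      realSymbol t q = realSymbol a q → ¬∀ p ∈ P, primeSymbol p t q = primeSymbol p a q) :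
    ∃ (R : Prop) (S : Finset ℕ), S ⊆ P ∧
      (∀ t : ℤ, t ≠ 0 → (∀ p : ℕ, p.Prime → (p : ℤ) ∣ t → p ∈ P) →
        (if R then realSymbol t q else 1) * ∏ p ∈ S, primeSymbol p t q = 1) ∧
      (if R then realSymbol a q else 1) * ∏ p ∈ S, primeSymbol p a q = -1 := by
  let φ : ℤ → Option P → ℤ := fun t i => i.elim (realSymbol t q) fun p => primeSymbol p t q
  have hφ : ∀ t ≠ 0, ∀ i, φ t i = 1 ∨ φ t i = -1 := by
    rintro t ht (_ | p)
    · exact realSymbol_eq_or t q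
    · exact primeSymbol_eq_or (hP p p.2) ht hq0
  have hφmul : ∀ s t : ℤ, s ≠ 0 → t ≠ 0 → φ (s * t) = φ s * φ t := by
    intro s t hs ht
    funext i
    rcases i with _ | p
    · exact realSymbol_mul_left hs ht q
    · exact primeSymbol_mul_left (hP p p.2) hs ht q
  obtain ⟨S, hS, hSa⟩ := exists_finset_prod_eq_neg_one
    {w | ∃ t : ℤ, t ≠ 0 ∧ (∀ p : ℕ, p.Prime → (p : ℤ) ∣ t → p ∈ P) ∧ φ t = w}
    (by rintro _ ⟨t, ht, -, rfl⟩; exact hφ t ht)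
    (by
      refine ⟨1, one_ne_zero, fun p hp hd =>
        absurd hd (Nat.prime_iff_prime_int.mp hp).not_dvd_one, ?_⟩
      funext i
      rcases i with _ | p
      · exact (realSymbol_comm _ _).trans (realSymbol_one_right q)
      · exact (primeSymbol_comm _ _ _).trans (primeSymbol_one_right (hP p p.2) q))
    (by
      rintro _ ⟨s, hs, hsP, rfl⟩ _ ⟨t, ht, htP, rfl⟩
      refine ⟨s * t, mul_ne_zero hs ht, fun p hp hd => ?_, hφmul s t hs ht⟩
      exact ((Nat.prime_iff_prime_int.mp hp).dvd_or_dvd hd).elim (hsP p hp) (htP p hp))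
    (φ a) (hφ a ha)
    (by
      rintro ⟨t, ht, htP, h⟩
      exact H t ht htP (congrFun h none) fun p hp => congrFun h (some ⟨p, hp⟩))
  refine ⟨none ∈ S, S.eraseNone.map (Function.Embedding.subtype (· ∈ P)), ?_, ?_, ?_⟩
  · intro p hp
    obtain ⟨r, -, rfl⟩ := Finset.mem_map.mp hp
    exact r.2
  · intro t ht htP
    refine Eq.trans ?_ (hS (φ t) ⟨t, ht, htP, rfl⟩)
    convert (prod_option_elim S (realSymbol t q) fun p => primeSymbol p t q).symm
  · refine Eq.trans ?_ hSa
    convert (prod_option_elim S (realSymbol a q) fun p => primeSymbol p a q).symm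

/-- A separating set of places gives an obstruction. -/
theorem exists_obstruction {a q : ℤ} (ha : a ≠ 0) (hq0 : q ≠ 0) {P : Finset ℕ}
    (hP : ∀ p ∈ P, p.Prime) (h2 : 2 ∈ P) (hrec : symbolProd P a q = 1)
    (H : ∀ t : ℤ, t ≠ 0 → (∀ p : ℕ, p.Prime → (p : ℤ) ∣ t → p ∈ P) →
      realSymbol t q = realSymbol a q → ¬∀ p ∈ P, primeSymbol p t q = primeSymbol p a q) :
    ∃ d : ℤ, d ≠ 0 ∧ d ∣ 2 * q ∧
      (IsSquareR (d : ℚ) ∨ IsSquareR ((d : ℚ) / (q : ℚ))) ∧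
      (∀ p ∈ P, IsSquareQp p (d : ℚ) ∨ IsSquareQp p ((d : ℚ) / (q : ℚ))) ∧
      (if ¬IsSquareR (d : ℚ) then realSymbol a q else 1) *
        (∏ p ∈ P, if ¬IsSquareQp p (d : ℚ) then primeSymbol p a q else 1) = -1 ∧
      (if IsSquareR (d : ℚ) then realSymbol a q else 1) *
        (∏ p ∈ P, if IsSquareQp p (d : ℚ) then primeSymbol p a q else 1) = -1 := by
  obtain ⟨R, S, hSP, hS, hSa⟩ := exists_separating_places ha hq0 hP H
  obtain ⟨d, hd0, hdq, hsign, hsq⟩ := exists_dvd_local_sq hP h2 hq0 R hSP hS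
  have hR : R → IsSquareR ((d : ℚ) / q) := by
    intro h
    rw [if_pos h] at hsign
    rw [isSquareR_iff]
    have h1 : 0 < d * q := by
      rw [← Int.sign_eq_one_iff_pos, Int.sign_mul, hsign]
      rcases sign_eq_or hq0 with h | h <;> rw [h] <;> rfl
    have h1 : (0 : ℚ) < d * q := by exact_mod_cast h1
    have hq' : (q : ℚ) ≠ 0 := by exact_mod_cast hq0
    rw [show (d : ℚ) / q = d * q / q ^ 2 by field_simp]
    positivity
  have hR' : ¬R → IsSquareR (d : ℚ) := by
    intro h
    rw [if_neg h, Int.sign_one, Int.sign_eq_one_iff_pos] at hsign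
    rw [isSquareR_iff]
    exact_mod_cast hsign.le
  have hp : ∀ p ∈ S, IsSquareQp p ((d : ℚ) / q) := by
    intro p hpS
    have := Fact.mk (hP p (hSP hpS))
    obtain ⟨x, hx⟩ := hsq p (hSP hpS)
    rw [if_pos hpS] at hx
    refine isSquareQp_iff.mpr ⟨x / q, ?_⟩
    have hq' : (q : ℚ_[p]) ≠ 0 := by exact_mod_cast hq0
    push_cast at hx ⊢
    rw [div_pow, ← hx]
    field_simp
  have hp' : ∀ p ∈ P, p ∉ S → IsSquareQp p (d : ℚ) := by
    intro p hpP hpS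
    have := Fact.mk (hP p hpP)
    obtain ⟨x, hx⟩ := hsq p hpP
    rw [if_neg hpS, mul_one] at hx
    exact isSquareQp_iff.mpr ⟨x, by exact_mod_cast hx⟩
  have hns : (if ¬IsSquareR (d : ℚ) then realSymbol a q else 1) *
      (∏ p ∈ P, if ¬IsSquareQp p (d : ℚ) then primeSymbol p a q else 1) = -1 := by
    rw [← hSa]
    congr 1
    · by_cases h : R
      · rw [if_pos h, ← realSymbol_eq_of_div_sq hd0 hq0 (hR h)]
        split_ifs with h1
        · rw [realSymbol_eq_one_of_sq h1]
        · rfl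
      · rw [if_neg h, if_neg (not_not.mpr (hR' h))]
    · rw [← Finset.prod_subset_one_on_sdiff hSP (fun p h => ?_) fun p h => ?_]
      · rw [Finset.mem_sdiff] at h
        exact if_neg (not_not.mpr (hp' p h.1 h.2))
      · have := Fact.mk (hP p (hSP h))
        rw [← primeSymbol_eq_of_div_sq ha hd0 hq0 (hp p h)]
        split_ifs with h1
        · rw [primeSymbol_eq_one_of_sq ha hd0 h1]
        · rfl
  refine ⟨d, hd0, hdq.mul_left 2, ?_, ?_, hns, ?_⟩
  · by_cases h : R
    · exact Or.inr (hR h)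
    · exact Or.inl (hR' h)
  · intro p hpP
    by_cases h : p ∈ S
    · exact Or.inr (hp p h)
    · exact Or.inl (hp' p hpP h)
  · have hite : ∀ (B : Prop) (x : ℤ), (if ¬B then x else 1) * (if B then x else 1) = x := by
      intro B x
      by_cases hB : B <;> simp [hB]
    have htot : symbolProd P a q = ((if ¬IsSquareR (d : ℚ) then realSymbol a q else 1) *
        (∏ p ∈ P, if ¬IsSquareQp p (d : ℚ) then primeSymbol p a q else 1)) *
        ((if IsSquareR (d : ℚ) then realSymbol a q else 1) *
        (∏ p ∈ P, if IsSquareQp p (d : ℚ) then primeSymbol p a q else 1)) := by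
      rw [mul_mul_mul_comm, hite, ← Finset.prod_mul_distrib,
        Finset.prod_congr rfl fun p _ => hite _ _]
      rfl
    rw [htot, hns] at hrec
    linarith

/-- Let `f(x,y) = ax² + bxy + cy²` with discriminant `q = b² − 4ac ≠ 0` not a rational
square, let `V = {∞, 2} ∪ {p prime : p ∣ q}` and `εᵥ = (a, −aq)ᵥ`.  Then `f` takes a
nonzero value of even `p`-adic valuation at all primes `p ∤ 2q` (i.e. the root stack
`P¹_{ℤ[1/2q]}[√f]` has a `ℤ[1/2q]`-point) if and only if there is no nonzero divisor
`d` of `2q` which is locally a square or `q` times a square at all `v ∈ V` and for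
which `∏_{v ∈ V, d ∉ ℚᵥ^{×2}} εᵥ = ∏_{v ∈ V, d ∈ ℚᵥ^{×2}} εᵥ = −1`. -/
theorem stmt_4 (a b c : ℤ) (q : ℤ) (hq : q = b ^ 2 - 4 * a * c) (hq0 : q ≠ 0)
    (hqns : ¬∃ s : ℚ, s ^ 2 = (q : ℚ)) :
    -- the finite set of primes in `V` (the place `∞` is treated separately)
    ∀ Vp : Finset ℕ, Vp = insert 2 q.natAbs.primeFactors →
    ∀ εinf : ℤ, εinf = hilbertR (a : ℚ) (-(a : ℚ) * (q : ℚ)) →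
    ∀ ε : ℕ → ℤ, (∀ p, ε p = hilbertQp p (a : ℚ) (-(a : ℚ) * (q : ℚ))) →
    ((∃ x y : ℚ,
        (a : ℚ) * x ^ 2 + (b : ℚ) * x * y + (c : ℚ) * y ^ 2 ≠ 0 ∧
        ∀ p : ℕ, p.Prime → ¬((p : ℤ) ∣ 2 * q) →
          Even (padicValRat p ((a : ℚ) * x ^ 2 + (b : ℚ) * x * y + (c : ℚ) * y ^ 2)))
      ↔
      ¬∃ d : ℤ, d ≠ 0 ∧ d ∣ 2 * q ∧
        -- at every `v ∈ V`, `d` or `d/q` is a square in `ℚᵥ^×`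
        (IsSquareR (d : ℚ) ∨ IsSquareR ((d : ℚ) / (q : ℚ))) ∧
        (∀ p ∈ Vp, IsSquareQp p (d : ℚ) ∨ IsSquareQp p ((d : ℚ) / (q : ℚ))) ∧
        -- `∏_{v ∈ V, d not a square in ℚᵥ} εᵥ = −1`
        (if ¬IsSquareR (d : ℚ) then εinf else 1) *
          (∏ p ∈ Vp, if ¬IsSquareQp p (d : ℚ) then ε p else 1) = -1 ∧
        -- `∏_{v ∈ V, d a square in ℚᵥ} εᵥ = −1`
        (if IsSquareR (d : ℚ) then εinf else 1) *
          (∏ p ∈ Vp, if IsSquareQp p (d : ℚ) then ε p else 1) = -1) := by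
  rintro Vp rfl εinf rfl ε hε
  have ha : a ≠ 0 := by
    rintro rfl
    exact hqns ⟨b, by rw [hq]; push_cast; ring⟩
  have hP : ∀ p : ℕ, p ∈ insert 2 q.natAbs.primeFactors ↔ p.Prime ∧ (p : ℤ) ∣ 2 * q := by
    intro p
    rw [Finset.mem_insert, Nat.mem_primeFactors]
    constructor
    · rintro (rfl | ⟨hp, hd, -⟩)
      · exact ⟨Nat.prime_two, by simp⟩
      · exact ⟨hp, (Int.natCast_dvd.mpr hd).mul_left _⟩
    · rintro ⟨hp, hd⟩
      rcases (Nat.prime_iff_prime_int.mp hp).dvd_or_dvd hd with hd | hd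
      · exact Or.inl ((Nat.prime_dvd_prime_iff_eq hp Nat.prime_two).mp (by exact_mod_cast hd))
      · exact Or.inr ⟨hp, Int.natCast_dvd.mp hd, by simpa using hq0⟩
  generalize insert 2 q.natAbs.primeFactors = P at hP ⊢
  have hprime : ∀ p ∈ P, p.Prime := fun p hp => ((hP p).mp hp).1
  have hε' : ∀ p ∈ P, ε p = primeSymbol p a q := fun p hp =>
    (hε p).trans (hilbertQp_neg_mul_eq_primeSymbol (hprime p hp) ha hq0)
  rw [hilbertR_neg_mul_eq_realSymbol ha]
  have hprod : ∀ (B : ℕ → Prop) [DecidablePred B], (∏ p ∈ P, if B p then ε p else 1) =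
      ∏ p ∈ P, if B p then primeSymbol p a q else 1 := fun B _ =>
    Finset.prod_congr rfl fun p hp => by rw [hε' p hp]
  simp only [hprod]
  constructor
  · rintro ⟨x, y, hf, heven⟩ ⟨d, hd0, hdq, hdR, hdP, hprod, -⟩
    rw [prod_eq_one_of_value hq ha hq0 hP hf heven hd0 hdq hdR hdP] at hprod
    norm_num at hprod
  · intro hno
    by_contra hnv
    refine hno (exists_obstruction ha hq0 hprime ((hP 2).mpr ⟨Nat.prime_two, by simp⟩)
      (symbolProd_discr_eq_one hq ha hq0 hP) fun t ht htP hR hpt => hnv ?_)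
    obtain ⟨x, y, hxy⟩ := exists_value_of_symbol_eq hq ha hq0 hqns hP ht htP hR hpt
    refine ⟨x, y, by rw [hxy]; exact_mod_cast ht, fun p hp hpq => ?_⟩
    have hpt : ¬(p : ℤ) ∣ t := fun hd => hpq ((hP p).mp (htP p hp hd)).2
    rw [hxy, padicValRat.of_int, padicValInt.eq_zero_of_not_dvd hpt]
    exact Even.zero
end

section
/- For every (x, y) ∈ ℚ² with (x, y) ≠ (0, 0), there exists a prime p ∉ {2, 7} such that v_p(3x² + 2xy + 5y²) is odd. -/
/-- If a squarefree natural number has only prime factors `2` and `7`, it divides `14`. -/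
theorem dvd_fourteen_of_squarefree {m : ℕ} (hm : Squarefree m)
    (h : ∀ p : ℕ, p.Prime → p ∣ m → p = 2 ∨ p = 7) : m ∣ 14 := by
  have hsub : m.primeFactors ⊆ {2, 7} := fun p hp => by
    simpa using h p (Nat.prime_of_mem_primeFactors hp) (Nat.dvd_of_mem_primeFactors hp)
  rw [← Nat.prod_primeFactors_of_squarefree hm]
  exact Finset.prod_dvd_prod_of_subset _ _ (fun p => p) hsub

/-- A positive integer whose valuations away from `2` and `7` are all even is a square times
a divisor of `14`. -/
theorem exists_sq_mul_dvd_fourteen {n : ℕ} (hn : n ≠ 0)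
    (h : ∀ p : ℕ, p.Prime → p ≠ 2 → p ≠ 7 → Even (padicValNat p n)) :
    ∃ m z : ℕ, m ∣ 14 ∧ n = m * z ^ 2 := by
  obtain ⟨m, z, hmz, hm⟩ := Nat.sq_mul_squarefree n
  refine ⟨m, z, dvd_fourteen_of_squarefree hm fun p hp hpm => ?_, by rw [← hmz, mul_comm]⟩
  by_contra! hne
  have : Fact p.Prime := ⟨hp⟩
  have hz : z ≠ 0 := by rintro rfl; simp at hmz; exact hn hmz.symm
  have hval : padicValNat p m = 1 := by
    rw [← Nat.factorization_def m hp]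
    exact le_antisymm (hm.natFactorization_le_one p)
      (hp.factorization_pos_of_dvd hm.ne_zero hpm)
  have heven := h p hp hne.1 hne.2
  rw [← hmz, padicValNat.mul (pow_ne_zero 2 hz) hm.ne_zero, padicValNat.pow, hval] at heven
  grind

/-- `3` is a quadratic nonresidue modulo `7`, and `2` is a residue. -/
theorem seven_dvd_of_three_mul_sq {u w : ℤ}
    (h : (7 : ℤ) ∣ 3 * u ^ 2 - w ^ 2 ∨ (7 : ℤ) ∣ 6 * u ^ 2 - w ^ 2) :
    (7 : ℤ) ∣ u ∧ (7 : ℤ) ∣ w := by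
  have hcast (t : ℤ) : (7 : ℤ) ∣ t ↔ (t : ZMod 7) = 0 :=
    (ZMod.intCast_zmod_eq_zero_iff_dvd t 7).symm
  simp only [hcast, Int.cast_sub, Int.cast_mul, Int.cast_pow, Int.cast_ofNat] at h ⊢
  revert h
  generalize (u : ZMod 7) = u
  generalize (w : ZMod 7) = w
  revert u w
  decide

theorem form_ne_of_isCoprime {a b m z : ℤ} (hab : IsCoprime a b)
    (hm : m = 1 ∨ m = 2 ∨ m = 7 ∨ m = 14) :
    3 * a ^ 2 + 2 * a * b + 5 * b ^ 2 ≠ m * z ^ 2 := by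
  intro h
  have hnorm : 3 * (m * z ^ 2) = (3 * a + b) ^ 2 + 14 * b ^ 2 := by rw [← h]; ring
  suffices hX : (7 : ℤ) ∣ 3 * a + b ∧ (7 : ℤ) ∣ b by
    have ha : (7 : ℤ) ∣ a := by omega
    have := hab.isUnit_of_dvd' ha hX.2
    norm_num [Int.isUnit_iff] at this
  have key_unit (hz : (7 : ℤ) ∣ z ∧ (7 : ℤ) ∣ 3 * a + b) :
      (7 : ℤ) ∣ 3 * a + b ∧ (7 : ℤ) ∣ b := by
    obtain ⟨⟨z', rfl⟩, X', hX'⟩ := hz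
    refine ⟨⟨X', hX'⟩, Int.Prime.dvd_pow' (by norm_num : Nat.Prime 7) (k := 2) ?_⟩
    rw [hX'] at hnorm
    generalize hB : b ^ 2 = B at hnorm ⊢
    have : 2 * B = 7 * (3 * (m * z' ^ 2) - X' ^ 2) := by linarith
    push_cast
    omega
  have key_ram {c : ℤ} (hc : c = 3 ∨ c = 6)
      (hnorm' : 7 * (c * z ^ 2) = (3 * a + b) ^ 2 + 14 * b ^ 2) :
      (7 : ℤ) ∣ 3 * a + b ∧ (7 : ℤ) ∣ b := by
    have hX : (7 : ℤ) ∣ 3 * a + b :=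
      Int.Prime.dvd_pow' (by norm_num : Nat.Prime 7) (k := 2)
        ⟨c * z ^ 2 - 2 * b ^ 2, by push_cast; linarith⟩
    refine ⟨hX, ?_⟩
    obtain ⟨X', hX'⟩ := hX
    rw [hX'] at hnorm'
    have hred : c * z ^ 2 = 7 * X' ^ 2 + 2 * b ^ 2 := by linarith
    suffices (7 : ℤ) ∣ 2 * b by omega
    rcases hc with rfl | rfl
    · exact (seven_dvd_of_three_mul_sq (u := z) (Or.inr ⟨2 * X' ^ 2, by linarith⟩)).2
    · exact (seven_dvd_of_three_mul_sq (u := 2 * z) (Or.inl ⟨2 * X' ^ 2, by linarith⟩)).2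
  rcases hm with rfl | rfl | rfl | rfl
  · exact key_unit (seven_dvd_of_three_mul_sq (Or.inl ⟨2 * b ^ 2, by linarith⟩))
  · exact key_unit (seven_dvd_of_three_mul_sq (Or.inr ⟨2 * b ^ 2, by linarith⟩))
  · exact key_ram (Or.inl rfl) (by linarith)
  · exact key_ram (Or.inr rfl) (by linarith)

/-- Every nonzero rational vector in the plane is a multiple of a primitive integral one. -/
theorem exists_eq_mul_isCoprime {x y : ℚ} (hxy : ¬(x = 0 ∧ y = 0)) :
    ∃ (c : ℚ) (a b : ℤ), c ≠ 0 ∧ IsCoprime a b ∧ x = c * a ∧ y = c * b := by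
  by_cases hy : y = 0
  · exact ⟨x, 1, 0, by tauto, isCoprime_one_left, by simp, by simp [hy]⟩
  · have hden : ((x / y).den : ℚ) ≠ 0 := by exact_mod_cast (x / y).den_nz
    refine ⟨y / (x / y).den, (x / y).num, (x / y).den, div_ne_zero hy hden,
      Rat.isCoprime_num_den _, ?_, ?_⟩
    · rw [div_mul_eq_mul_div, mul_div_assoc, Rat.num_div_den, mul_div_cancel₀ _ hy]
    · rw [Int.cast_natCast, div_mul_cancel₀ _ hden]


/-- For every `(x, y) ∈ ℚ²` with `(x, y) ≠ (0, 0)` there is a prime `p ∉ {2, 7}` such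
that the `p`-adic valuation of `3x² + 2xy + 5y²` is odd.  (This form has discriminant
`q = −56`; the associated root stack `P¹_{ℤ[1/14]}[√f]` has no `ℤ[1/14]`-point.) -/
theorem stmt_5 (x y : ℚ) (hxy : ¬(x = 0 ∧ y = 0)) :
    ∃ p : ℕ, p.Prime ∧ p ≠ 2 ∧ p ≠ 7 ∧
      Odd (padicValRat p (3 * x ^ 2 + 2 * x * y + 5 * y ^ 2)) := by
  by_contra! hodd
  obtain ⟨c, a, b, hc, hab, rfl, rfl⟩ := exists_eq_mul_isCoprime hxy
  have hpos : 0 < 3 * a ^ 2 + 2 * a * b + 5 * b ^ 2 := by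
    rcases hab.ne_zero_or_ne_zero with h | h
    · nlinarith [sq_nonneg (a + b), pow_pos (abs_pos.mpr h) 2, sq_abs a, sq_nonneg b]
    · nlinarith [sq_nonneg (a + b), pow_pos (abs_pos.mpr h) 2, sq_abs b, sq_nonneg a]
  obtain ⟨n, hn⟩ := Int.eq_ofNat_of_zero_le hpos.le
  have hn0 : n ≠ 0 := by omega
  have hform : 3 * (c * a) ^ 2 + 2 * (c * a) * (c * b) + 5 * (c * b) ^ 2 = c ^ 2 * (n : ℚ) := by
    have hnq : (3 * a ^ 2 + 2 * a * b + 5 * b ^ 2 : ℚ) = n := by exact_mod_cast hn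
    rw [← hnq]
    ring
  obtain ⟨m, z, hm, hmz⟩ := exists_sq_mul_dvd_fourteen hn0 fun p hp h2 h7 => by
    have : Fact p.Prime := ⟨hp⟩
    have heven := hodd p hp h2 h7
    rw [hform, padicValRat.mul (pow_ne_zero 2 hc) (by exact_mod_cast hn0), padicValRat.pow,
      padicValRat.of_nat, Int.not_odd_iff_even] at heven
    grind
  refine form_ne_of_isCoprime (m := m) (z := z) hab ?_ (by rw [hn, hmz]; push_cast; rfl)
  have hmem : m ∈ Nat.divisors 14 := by simpa using hm
  rw [show Nat.divisors 14 = {1, 2, 7, 14} by decide] at hmem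
  simp only [Finset.mem_insert, Finset.mem_singleton] at hmem
  exact_mod_cast hmem
end

section
/- For every (x, y) ∈ ℚ² with (x, y) ≠ (0, 0), there exists a prime ℓ ∉ {2, 7, 31, 47} such that v_ℓ(3x² + xy + 850y²) is odd. -/
/-- Since `3` is not a square modulo `31`, the form `s² - 3k²t²` is anisotropic modulo `31`
for every `k` prime to `31`. -/
theorem dvd_and_dvd_of_dvd_sq_sub {r k s t : ℤ} (hk : ¬ 31 ∣ k) (hr : 31 ∣ r - k ^ 2)
    (h : 31 ∣ s ^ 2 - 3 * r * t ^ 2) : (31 : ℤ) ∣ s ∧ (31 : ℤ) ∣ t := by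
  have hp : Prime (31 : ℤ) := by norm_num
  have hsq : ∀ a b : ZMod 31, a ^ 2 - 3 * b ^ 2 = 0 → a = 0 ∧ b = 0 := by decide
  have h' : (31 : ℤ) ∣ s ^ 2 - 3 * (k * t) ^ 2 := by
    rw [show s ^ 2 - 3 * (k * t) ^ 2 = s ^ 2 - 3 * r * t ^ 2 + (r - k ^ 2) * (3 * t ^ 2) by ring]
    exact dvd_add h (hr.mul_right _)
  have h0 := hsq s (k * t : ℤ) (by exact_mod_cast (ZMod.intCast_zmod_eq_zero_iff_dvd _ 31).2 h')
  simp only [ZMod.intCast_zmod_eq_zero_iff_dvd] at h0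
  exact ⟨h0.1, (hp.dvd_or_dvd h0.2).resolve_left hk⟩

/-- If `r` is a nonzero square modulo `31`, then `u² + 10199v² = 3rz²` forces `z = 0`. -/
theorem eq_zero_of_sq_add_eq_three_mul {r k : ℤ} (hk : ¬ 31 ∣ k) (hr : 31 ∣ r - k ^ 2)
    (n : ℕ) : ∀ u v z : ℤ, z.natAbs = n → u ^ 2 + 10199 * v ^ 2 = 3 * r * z ^ 2 → z = 0 := by
  induction n using Nat.strong_induction_on with
  | _ n ih =>
    intro u v z hz h
    have hp : Prime (31 : ℤ) := by norm_num
    by_contra hz0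
    obtain ⟨⟨u, rfl⟩, ⟨z, rfl⟩⟩ := dvd_and_dvd_of_dvd_sq_sub hk hr
      (s := u) (t := z) ⟨-329 * v ^ 2, by linear_combination h⟩
    have hv : (31 : ℤ) ∣ v := by
      have : (31 : ℤ) ∣ 329 * v ^ 2 := ⟨3 * r * z ^ 2 - u ^ 2, by linarith⟩
      exact hp.dvd_of_dvd_pow ((hp.dvd_or_dvd this).resolve_left (by norm_num))
    obtain ⟨v, rfl⟩ := hv
    have := ih z.natAbs (by omega) u v z rfl (by linarith)
    omega

/-- If `r` is a nonzero square modulo `31`, then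
`u² + 10199v² = 3 · 31 · r · z²` forces `z = 0`. -/
theorem eq_zero_of_sq_add_eq_three_mul_thirty_one_mul {r k : ℤ} (hk : ¬ 31 ∣ k)
    (hr : 31 ∣ r - k ^ 2) (n : ℕ) : ∀ u v z : ℤ, z.natAbs = n →
      u ^ 2 + 10199 * v ^ 2 = 3 * (31 * r) * z ^ 2 → z = 0 := by
  induction n using Nat.strong_induction_on with
  | _ n ih =>
    intro u v z hz h
    have hp : Prime (31 : ℤ) := by norm_num
    by_contra hz0
    obtain ⟨u, rfl⟩ : (31 : ℤ) ∣ u :=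
      hp.dvd_of_dvd_pow (n := 2) ⟨3 * r * z ^ 2 - 329 * v ^ 2, by linarith⟩
    obtain ⟨hv, ⟨z, rfl⟩⟩ := dvd_and_dvd_of_dvd_sq_sub hk hr
      (s := 9 * v) (t := z) ⟨-u ^ 2 - 8 * v ^ 2, by linarith⟩
    obtain ⟨v, rfl⟩ := (hp.dvd_or_dvd hv).resolve_left (by norm_num)
    have := ih z.natAbs (by omega) u v z rfl (by linarith)
    omega

/-- A product of distinct primes among `2, 7, 47` is a nonzero square modulo `31`. -/
theorem exists_dvd_sub_sq_of_dvd {r : ℕ} (hr : r ∣ 658) :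
    ∃ k : ℤ, ¬ 31 ∣ k ∧ (31 : ℤ) ∣ r - k ^ 2 := by
  have hdiv : ∀ r ∈ Nat.divisors 658, ∃ k : Fin 31, ¬ (31 : ℤ) ∣ (k : ℕ) ∧
      (31 : ℤ) ∣ r - (k : ℕ) ^ 2 := by
    have : Nat.divisors 658 = {1, 2, 7, 14, 47, 94, 329, 658} := by decide +kernel
    rw [this]
    decide
  obtain ⟨k, hk⟩ := hdiv r (by simp [hr])
  exact ⟨_, hk⟩

theorem padicValRat_sq_mul_squarefree {l a : ℕ} (hl : l.Prime) (ha : Squarefree a) (hla : l ∣ a)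
    {q : ℚ} (hq : q ≠ 0) : Odd (padicValRat l (q ^ 2 * a)) := by
  have : Fact l.Prime := ⟨hl⟩
  have ha0 : (a : ℚ) ≠ 0 := by exact_mod_cast ha.ne_zero
  have h1 : padicValNat l a = 1 := by
    rw [← Nat.factorization_def a hl]
    exact le_antisymm (ha.natFactorization_le_one l)
      ((hl.dvd_iff_one_le_factorization ha.ne_zero).1 hla)
  rw [padicValRat.mul (pow_ne_zero 2 hq) ha0, padicValRat.pow, padicValRat.of_nat, h1]
  exact ⟨padicValRat l q, by push_cast; ring⟩

/-- For every `(x, y) ∈ ℚ²` with `(x, y) ≠ (0, 0)` there is a prime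
`ℓ ∉ {2, 7, 31, 47}` such that the `ℓ`-adic valuation of `3x² + xy + 850y²` is odd.
(This is the explicit instance of the Bhargava–Poonen family with
discriminant `−10199 = −7·47·31`.) -/
theorem stmt_7 (x y : ℚ) (hxy : ¬(x = 0 ∧ y = 0)) :
    ∃ l : ℕ, l.Prime ∧ l ≠ 2 ∧ l ≠ 7 ∧ l ≠ 31 ∧ l ≠ 47 ∧
      Odd (padicValRat l (3 * x ^ 2 + x * y + 850 * y ^ 2)) := by
  obtain ⟨X, Y, d, hd, rfl, rfl⟩ : ∃ X Y d : ℤ, d ≠ 0 ∧ x = X / d ∧ y = Y / d := by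
    have hx : (x.den : ℚ) ≠ 0 := by exact_mod_cast x.den_ne_zero
    have hy : (y.den : ℚ) ≠ 0 := by exact_mod_cast y.den_ne_zero
    refine ⟨x.num * y.den, y.num * x.den, x.den * y.den, by simp, ?_, ?_⟩
    · push_cast
      rw [mul_div_mul_right _ _ hy, Rat.num_div_den]
    · push_cast
      rw [mul_comm (x.den : ℚ), mul_div_mul_right _ _ hx, Rat.num_div_den]
  have hd' : (d : ℚ) ≠ 0 := by exact_mod_cast hd
  have hpos : 0 < 3 * X ^ 2 + X * Y + 850 * Y ^ 2 := by
    by_contra! hle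
    have hY : Y = 0 := by nlinarith [sq_nonneg (6 * X + Y), sq_nonneg Y]
    have hX : X = 0 := by subst hY; nlinarith [sq_nonneg X]
    exact hxy (by simp [hX, hY])
  obtain ⟨N, hN⟩ := Int.eq_ofNat_of_zero_le hpos.le
  obtain ⟨a, b, hab, ha⟩ := Nat.sq_mul_squarefree N
  have hF : 3 * X ^ 2 + X * Y + 850 * Y ^ 2 = (b : ℤ) ^ 2 * a := by
    rw [hN, ← hab]
    push_cast
    rfl
  have hb : (b : ℤ) ≠ 0 := by
    intro hb
    simp [hb] at hF
    omega
  have hval : 3 * ((X : ℚ) / d) ^ 2 + X / d * (Y / d) + 850 * (Y / d) ^ 2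
      = ((b : ℚ) / d) ^ 2 * a := by
    have : 3 * (X : ℚ) ^ 2 + X * Y + 850 * Y ^ 2 = (b : ℚ) ^ 2 * a := by exact_mod_cast hF
    field_simp
    linear_combination this
  have hq : (b : ℚ) / d ≠ 0 := div_ne_zero (by exact_mod_cast hb) hd'
  rw [hval]
  by_contra! hcon
  have hprimes : ∀ l : ℕ, l.Prime → l ∣ a → l ∣ 31 * 658 := by
    intro l hl hla
    by_contra hndvd
    refine hcon l hl ?_ ?_ ?_ ?_ (padicValRat_sq_mul_squarefree hl ha hla hq) <;>
    · rintro rfl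
      exact hndvd (by norm_num)
  have hdvd : a ∣ 31 * 658 := by
    rw [← Nat.prod_primeFactors_of_squarefree ha]
    refine (Finset.prod_dvd_prod_of_subset _ (31 * 658).primeFactors _ fun l hl => ?_).trans
      (Nat.prod_primeFactors_dvd _)
    have hl' := Nat.prime_of_mem_primeFactors hl
    exact Nat.mem_primeFactors.2
      ⟨hl', hprimes l hl' (Nat.dvd_of_mem_primeFactors hl), by norm_num⟩
  have hform : (6 * X + Y) ^ 2 + 10199 * Y ^ 2 = 3 * (a : ℤ) * (2 * b) ^ 2 := by
    linear_combination 12 * hF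
  have h2b : (2 * b : ℤ) ≠ 0 := by simpa using hb
  by_cases h31 : 31 ∣ a
  · obtain ⟨r, rfl⟩ := h31
    obtain ⟨k, hk, hr⟩ := exists_dvd_sub_sq_of_dvd (Nat.dvd_of_mul_dvd_mul_left (by norm_num) hdvd)
    exact h2b (eq_zero_of_sq_add_eq_three_mul_thirty_one_mul hk hr _ _ _ _ rfl
      (by exact_mod_cast hform))
  · have hcop : a.Coprime 31 := ((Nat.Prime.coprime_iff_not_dvd (by norm_num)).2 h31).symm
    obtain ⟨k, hk, hr⟩ := exists_dvd_sub_sq_of_dvd (hcop.dvd_of_dvd_mul_left hdvd)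
    exact h2b (eq_zero_of_sq_add_eq_three_mul hk hr _ _ _ _ rfl hform)
end
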